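/- Let (A_1,…,A_ℓ) be invertible d×d real matrices such that for every positive integer t dividing d the cocycle 𝒜^t is irreducible (no subspace V of ℝ^d with V ≠ {0} and V ≠ ℝ^d satisfies A_I V ⊆ V for every word I of length t), and for every 1 ≤ m ≤ d−1 the cocycle 𝒜^{∧m} is irreducible (no subspace W of ⋀^m ℝ^d with W ≠ {0} and W ≠ ⋀^m ℝ^d satisfies (⋀^m A_i) W ⊆ W for every i). Let s > 0 and let μ be a σ-invariant Borel probability measure on Σ_ℓ satisfying the Gibbs property for Φ_𝒜^s with pressure P ∈ ℝ and constant C_0 > 1. Then μ is ψ-mixing: lim_{n→∞} sup_{I,J finite words} | μ([I] ∩ σ^{−(n+|I|)}[J]) / (μ([I]) μ([J])) − 1 | = 0. -/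

import Mathlib

open Matrix MeasureTheory

/-- For a word `I = [i₀, i₁, …, i_{n-1}]`, the cocycle product
`A_I = A_{i_{n-1}} ⋯ A_{i₀}`. -/
noncomputable def wordProd {ℓ d : ℕ} (A : Fin ℓ → Matrix (Fin d) (Fin d) ℝ)
    (I : List (Fin ℓ)) : Matrix (Fin d) (Fin d) ℝ :=
  I.foldl (fun B i => A i * B) 1

/-- The operator norm of a matrix, viewed as a linear operator on Euclidean space. -/
noncomputable def opNorm {d : ℕ} (M : Matrix (Fin d) (Fin d) ℝ) : ℝ :=
  ‖Matrix.toEuclideanCLM (𝕜 := ℝ) M‖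

/-- The left shift on the full one-sided shift space `Σ_ℓ = {1,…,ℓ}^ℕ`. -/
def shift (ℓ : ℕ) : (ℕ → Fin ℓ) → (ℕ → Fin ℓ) := fun x n => x (n + 1)

/-- The cylinder set `[I]` of sequences starting with the word `I`. -/
def cylinder {ℓ : ℕ} (I : List (Fin ℓ)) : Set (ℕ → Fin ℓ) :=
  {x | ∀ k : Fin I.length, x k = I.get k}

section Auxiliary

open Filter Topology

variable {ℓ d : ℕ}

section Words

/-- The finite set of words of length `n`. -/
def words (ℓ : ℕ) : ℕ → Finset (List (Fin ℓ))
  | 0 => {[]}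
  | n + 1 => (Finset.univ ×ˢ words ℓ n).image fun x => x.1 :: x.2


theorem mem_words {n : ℕ} {I : List (Fin ℓ)} : I ∈ words ℓ n ↔ I.length = n := by
  induction n generalizing I with
  | zero => simp [words]
  | succ n ih =>
    cases I with
    | nil => simp [words]
    | cons i I => simp [words, ih]

theorem sum_words_zero (f : List (Fin ℓ) → ℝ) : ∑ K ∈ words ℓ 0, f K = f [] := by
  simp [words]

theorem sum_words_succ (n : ℕ) (f : List (Fin ℓ) → ℝ) :
    ∑ K ∈ words ℓ (n + 1), f K = ∑ i, ∑ K ∈ words ℓ n, f (i :: K) := by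
  rw [words, Finset.sum_image, Finset.sum_product]
  rintro ⟨i, K⟩ _ ⟨j, L⟩ _ h
  simpa using h

theorem sum_words_add (m n : ℕ) (f : List (Fin ℓ) → ℝ) :
    ∑ K ∈ words ℓ (m + n), f K = ∑ K ∈ words ℓ m, ∑ L ∈ words ℓ n, f (K ++ L) := by
  induction m generalizing f with
  | zero => simp [sum_words_zero]
  | succ m ih =>
    rw [Nat.succ_add, sum_words_succ, sum_words_succ]
    exact Finset.sum_congr rfl fun i _ => by simp [ih]

theorem sum_words_one (f : List (Fin ℓ) → ℝ) : ∑ K ∈ words ℓ 1, f K = ∑ i, f [i] := by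
  simp [sum_words_succ, sum_words_zero]

/-- The weights given to cylinders by a fully supported shift-invariant probability measure. -/
structure IsInvariantWeight (p : List (Fin ℓ) → ℝ) : Prop where
  pos : ∀ I, 0 < p I
  nil : p [] = 1
  left : ∀ I, p I = ∑ i, p (i :: I)
  right : ∀ I, p I = ∑ i, p (I ++ [i])

/-- If `f` is the sum of its one-letter right extensions, it is the sum of its extensions of any
given length. -/
theorem sum_append_right {f : List (Fin ℓ) → ℝ} (hf : ∀ I, f I = ∑ i, f (I ++ [i])) (n : ℕ)
    (I : List (Fin ℓ)) : ∑ K ∈ words ℓ n, f (I ++ K) = f I := by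
  induction n generalizing I with
  | zero => simp [sum_words_zero]
  | succ n ih =>
    rw [sum_words_succ, hf I]
    exact Finset.sum_congr rfl fun i _ => by simpa using ih (I ++ [i])

theorem sum_append_left {f : List (Fin ℓ) → ℝ} (hf : ∀ I, f I = ∑ i, f (i :: I)) (n : ℕ)
    (I : List (Fin ℓ)) : ∑ K ∈ words ℓ n, f (K ++ I) = f I := by
  induction n with
  | zero => simp [sum_words_zero]
  | succ n ih =>
    rw [sum_words_succ, Finset.sum_comm, ← ih]
    exact Finset.sum_congr rfl fun K _ => by simpa using (hf (K ++ I)).symm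

theorem sum_append_left_iterate {p : List (Fin ℓ) → ℝ} {y : ℕ → List (Fin ℓ) → ℝ}
    (h : ∀ n J, p J * y (n + 1) J = ∑ i, p (i :: J) * y n (i :: J)) (m n : ℕ)
    (J : List (Fin ℓ)) :
    ∑ K ∈ words ℓ m, p (K ++ J) * y n (K ++ J) = p J * y (n + m) J := by
  induction m generalizing n with
  | zero => simp [sum_words_zero]
  | succ m ih =>
    rw [sum_words_succ, Finset.sum_comm, show n + (m + 1) = n + 1 + m by ring, ← ih]
    exact Finset.sum_congr rfl fun K _ => by simpa using (h n (K ++ J)).symm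

/-- The variance identity for a finite weighted family. -/
theorem sum_mul_sub_sq {ι : Type*} (s : Finset ι) (a z : ι → ℝ) (P w : ℝ)
    (h1 : ∑ k ∈ s, a k = P) (h2 : ∑ k ∈ s, a k * z k = P * w) :
    ∑ k ∈ s, a k * (z k - w) ^ 2 = ∑ k ∈ s, a k * z k ^ 2 - P * w ^ 2 := by
  have : ∀ k, a k * (z k - w) ^ 2 = a k * z k ^ 2 - 2 * w * (a k * z k) + w ^ 2 * a k := by
    intro k; ring
  simp only [this, Finset.sum_add_distrib, Finset.sum_sub_distrib, ← Finset.mul_sum, h1, h2]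
  ring

theorem lower_bound_of_le {p : List (Fin ℓ) → ℝ} (hp : IsInvariantWeight p) {c : ℝ} {n₀ : ℕ}
    (hlow : ∀ I J, c * p I * p J ≤ ∑ K ∈ words ℓ n₀, p (I ++ K ++ J)) {r : ℕ} (hr : n₀ ≤ r)
    (I J : List (Fin ℓ)) : c * p I * p J ≤ ∑ K ∈ words ℓ r, p (I ++ K ++ J) := by
  obtain ⟨k, rfl⟩ := Nat.exists_eq_add_of_le' hr
  rw [sum_words_add, ← sum_append_right hp.right k I, Finset.mul_sum, Finset.sum_mul]
  exact Finset.sum_le_sum fun K _ => by simpa using hlow (I ++ K) J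

/-- The second moment at level `q`. -/
def secondMoment (p y : List (Fin ℓ) → ℝ) (q : ℕ) : ℝ := ∑ J ∈ words ℓ q, p J * y J ^ 2

section Recurrence

variable {p : List (Fin ℓ) → ℝ}

theorem secondMoment_le (hp : IsInvariantWeight p) {y : List (Fin ℓ) → ℝ} {C : ℝ}
    (hC : ∀ J, |y J| ≤ C) (q : ℕ) : secondMoment p y q ≤ C ^ 2 := by
  have h : ∑ J ∈ words ℓ q, p J = 1 := by simpa [hp.nil] using sum_append_right hp.right q []
  calc secondMoment p y q ≤ ∑ J ∈ words ℓ q, p J * C ^ 2 :=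
        Finset.sum_le_sum fun J _ =>
          mul_le_mul_of_nonneg_left (sq_le_sq.2 ((hC J).trans (le_abs_self C))) (hp.pos J).le
    _ = C ^ 2 := by rw [← Finset.sum_mul, h, one_mul]

theorem secondMoment_right (hp : IsInvariantWeight p) {y : List (Fin ℓ) → ℝ}
    (hm : ∀ J, p J * y J = ∑ i, p (J ++ [i]) * y (J ++ [i])) (q m : ℕ) :
    ∑ I ∈ words ℓ q, ∑ L ∈ words ℓ m, p (I ++ L) * (y (I ++ L) - y I) ^ 2 =
      secondMoment p y (q + m) - secondMoment p y q := by
  rw [secondMoment, secondMoment, sum_words_add, ← Finset.sum_sub_distrib]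
  refine Finset.sum_congr rfl fun I _ => ?_
  exact sum_mul_sub_sq _ _ _ _ _ (sum_append_right hp.right m I)
    (sum_append_right (f := fun J => p J * y J) hm m I)

theorem secondMoment_left (hp : IsInvariantWeight p) {y : ℕ → List (Fin ℓ) → ℝ}
    (h : ∀ n J, p J * y (n + 1) J = ∑ i, p (i :: J) * y n (i :: J)) (n m q : ℕ) :
    ∑ J ∈ words ℓ q, ∑ K ∈ words ℓ m, p (K ++ J) * (y n (K ++ J) - y (n + m) J) ^ 2 =
      secondMoment p (y n) (m + q) - secondMoment p (y (n + m)) q := by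
  have e : secondMoment p (y n) (m + q) =
      ∑ J ∈ words ℓ q, ∑ K ∈ words ℓ m, p (K ++ J) * y n (K ++ J) ^ 2 := by
    rw [secondMoment, sum_words_add, Finset.sum_comm]
  rw [e, secondMoment, ← Finset.sum_sub_distrib]
  exact Finset.sum_congr rfl fun J _ => sum_mul_sub_sq _ _ _ _ _ (sum_append_left hp.left m J)
    (sum_append_left_iterate h m n J)

/-- Splitting a long word as `I ++ R ++ J`, the prefix and suffix values of `y` are compared through
the value on the whole word. -/
theorem sum_prefix_suffix_le (hp : IsInvariantWeight p) {y : ℕ → List (Fin ℓ) → ℝ}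
    (hm : ∀ n J, p J * y n J = ∑ i, p (J ++ [i]) * y n (J ++ [i]))
    (h : ∀ n J, p J * y (n + 1) J = ∑ i, p (i :: J) * y n (i :: J)) {ε : ℝ} (n q r : ℕ)
    (hε : ∀ J, |y (n + (q + r)) J - y n J| ≤ ε) :
    ∑ I ∈ words ℓ q, ∑ R ∈ words ℓ r, ∑ J ∈ words ℓ q, p (I ++ R ++ J) * (y n I - y n J) ^ 2 ≤
      3 * ((secondMoment p (y n) (q + r + q) - secondMoment p (y n) q) +
        (secondMoment p (y n) (q + r + q) - secondMoment p (y (n + (q + r))) q) + ε ^ 2) := by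
  have t1 := secondMoment_right hp (hm n) q (r + q)
  simp only [sum_words_add] at t1
  have t2 := secondMoment_left hp h n (q + r) q
  rw [Finset.sum_comm] at t2
  simp only [sum_words_add] at t2
  have t3 : ∑ I ∈ words ℓ q, ∑ R ∈ words ℓ r, ∑ J ∈ words ℓ q, p (I ++ R ++ J) = 1 := by
    rw [← sum_words_add q r fun K => ∑ J ∈ words ℓ q, p (K ++ J), ← sum_words_add,
      ← hp.nil, ← sum_append_right hp.right (q + r + q) []]
    rfl
  have key : ∀ I R J, p (I ++ R ++ J) * (y n I - y n J) ^ 2 ≤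
      3 * (p (I ++ (R ++ J)) * (y n (I ++ (R ++ J)) - y n I) ^ 2 +
        p (I ++ R ++ J) * (y n (I ++ R ++ J) - y (n + (q + r)) J) ^ 2 + p (I ++ R ++ J) * ε ^ 2) := by
    intro I R J
    rw [← List.append_assoc, ← mul_add, ← mul_add, mul_left_comm]
    refine mul_le_mul_of_nonneg_left ?_ (hp.pos _).le
    have := sq_le_sq.2 ((hε J).trans (le_abs_self ε))
    nlinarith [sq_nonneg ((y n (I ++ R ++ J) - y n I) + (y n (I ++ R ++ J) - y (n + (q + r)) J)),
      sq_nonneg ((y n (I ++ R ++ J) - y n I) + (y (n + (q + r)) J - y n J)),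
      sq_nonneg ((y n (I ++ R ++ J) - y (n + (q + r)) J) - (y (n + (q + r)) J - y n J))]
  calc _ ≤ ∑ I ∈ words ℓ q, ∑ R ∈ words ℓ r, ∑ J ∈ words ℓ q, _ :=
        Finset.sum_le_sum fun I _ => Finset.sum_le_sum fun R _ => Finset.sum_le_sum fun J _ =>
          key I R J
    _ = _ := by
      simp only [← Finset.mul_sum, Finset.sum_add_distrib, ← Finset.sum_mul, t3]
      rw [t1, t2, add_assoc q r q, one_mul]

/-- A bounded family of martingales that is generated by the shift and that is recurrent tends to
its mean, provided cylinders are quasi-independent from below. -/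
theorem tendsto_zero_of_recurrent (hp : IsInvariantWeight p) {c : ℝ} (hc : 0 < c) {n₀ : ℕ}
    (hlow : ∀ I J, c * p I * p J ≤ ∑ K ∈ words ℓ n₀, p (I ++ K ++ J))
    {y : ℕ → List (Fin ℓ) → ℝ} {C : ℝ} (hC : ∀ n J, |y n J| ≤ C)
    (hm : ∀ n J, p J * y n J = ∑ i, p (J ++ [i]) * y n (J ++ [i]))
    (h : ∀ n J, p J * y (n + 1) J = ∑ i, p (i :: J) * y n (i :: J))
    (h0 : ∀ n, y n [] = 0)
    (hrec : ∀ ε : ℝ, 0 < ε → ∃ n, ∀ M, ∃ m ≥ M, ∀ J, |y (n + m) J - y n J| ≤ ε)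
    (J : List (Fin ℓ)) : Tendsto (fun n => y n J) atTop (𝓝 0) := by
  have hC0 : 0 ≤ C := (abs_nonneg _).trans (hC 0 [])
  have sum_p : ∀ q, ∑ J ∈ words ℓ q, p J = 1 := fun q => by
    simpa [hp.nil] using sum_append_right hp.right q []
  have sum_py : ∀ n q, ∑ J ∈ words ℓ q, p J * y n J = 0 := fun n q => by
    simpa [h0] using sum_append_right (f := fun J => p J * y n J) (hm n) q []
  have small : ∀ ε : ℝ, 0 < ε → ∃ n, ∀ q, secondMoment p (y n) q ≤
      3 / (2 * c) * (2 * ε + 2 * C * ε + ε ^ 2) + ε := by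
    intro ε hε
    obtain ⟨n, hn⟩ := hrec ε hε
    refine ⟨n, ?_⟩
    have bdd : BddAbove (Set.range (secondMoment p (y n))) :=
      ⟨C ^ 2, by rintro _ ⟨q, rfl⟩; exact secondMoment_le hp (hC n) q⟩
    obtain ⟨q, hq⟩ := exists_lt_of_lt_ciSup (sub_lt_self (⨆ q, secondMoment p (y n) q) hε)
    obtain ⟨m, hmge, hmε⟩ := hn (q + n₀)
    obtain ⟨r, rfl⟩ := Nat.exists_eq_add_of_le (show q ≤ m by omega)
    have S := sum_prefix_suffix_le hp hm h n q r hmε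
    have hsup := le_ciSup bdd (q + r + q)
    have close : secondMoment p (y n) q - secondMoment p (y (n + (q + r))) q ≤ 2 * C * ε := by
      rw [secondMoment, secondMoment, ← Finset.sum_sub_distrib]
      calc _ ≤ ∑ J ∈ words ℓ q, p J * (2 * C * ε) := Finset.sum_le_sum fun J _ => by
            rw [← mul_sub]
            refine mul_le_mul_of_nonneg_left ?_ (hp.pos J).le
            have e : y n J ^ 2 - y (n + (q + r)) J ^ 2 =
              (y n J + y (n + (q + r)) J) * (y n J - y (n + (q + r)) J) := by ring
            rw [e]
            refine (le_abs_self _).trans ?_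
            rw [abs_mul, abs_sub_comm (y n J)]
            refine mul_le_mul ?_ (hmε J) (abs_nonneg _) (by positivity)
            exact (abs_add_le _ _).trans (by linarith [hC n J, hC (n + (q + r)) J])
        _ = _ := by rw [← Finset.sum_mul, sum_p, one_mul]
    have low : 2 * c * secondMoment p (y n) q ≤ ∑ I ∈ words ℓ q, ∑ R ∈ words ℓ r,
        ∑ J ∈ words ℓ q, p (I ++ R ++ J) * (y n I - y n J) ^ 2 := by
      calc 2 * c * secondMoment p (y n) q
          = ∑ I ∈ words ℓ q, ∑ J ∈ words ℓ q, c * p I * p J * (y n I - y n J) ^ 2 := by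
            have e : ∀ I J, c * p I * p J * (y n I - y n J) ^ 2 =
                c * ((p I * y n I ^ 2) * p J) - c * 2 * ((p I * y n I) * (p J * y n J)) +
                c * (p I * (p J * y n J ^ 2)) := by intro I J; ring
            simp only [e, Finset.sum_add_distrib, Finset.sum_sub_distrib, ← Finset.mul_sum,
              ← Finset.sum_mul, sum_p, sum_py]
            simp only [secondMoment]; ring
        _ ≤ ∑ I ∈ words ℓ q, ∑ J ∈ words ℓ q, ∑ R ∈ words ℓ r,
              p (I ++ R ++ J) * (y n I - y n J) ^ 2 := by
            refine Finset.sum_le_sum fun I _ => Finset.sum_le_sum fun J _ => ?_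
            rw [← Finset.sum_mul]
            exact mul_le_mul_of_nonneg_right
              (lower_bound_of_le hp hlow (by omega) I J) (sq_nonneg _)
        _ = _ := Finset.sum_congr rfl fun I _ => Finset.sum_comm
    intro q'
    have hq' := le_ciSup bdd q'
    have : secondMoment p (y n) q ≤ 3 / (2 * c) * (2 * ε + 2 * C * ε + ε ^ 2) := by
      rw [div_mul_eq_mul_div, le_div_iff₀ (by positivity)]
      nlinarith
    linarith
  have step : ∀ n m q, secondMoment p (y (n + m)) q ≤ secondMoment p (y n) (m + q) := by
    intro n m q
    rw [← sub_nonneg, ← secondMoment_left hp h]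
    exact Finset.sum_nonneg fun I _ => Finset.sum_nonneg fun L _ =>
      mul_nonneg (hp.pos _).le (sq_nonneg _)
  have lim : Tendsto (fun ε : ℝ => 3 / (2 * c) * (2 * ε + 2 * C * ε + ε ^ 2) + ε) (𝓝[>] 0)
      (𝓝 0) := by
    refine Tendsto.mono_left ?_ nhdsWithin_le_nhds
    have : Continuous fun ε : ℝ => 3 / (2 * c) * (2 * ε + 2 * C * ε + ε ^ 2) + ε := by fun_prop
    simpa using this.tendsto 0
  rw [Metric.tendsto_atTop]
  intro η hη
  obtain ⟨ε, hεη, hε⟩ := ((lim.eventually_lt_const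
    (show 0 < p J * η ^ 2 from mul_pos (hp.pos J) (by positivity))).and
      self_mem_nhdsWithin).exists
  obtain ⟨n, hn⟩ := small ε hε
  refine ⟨n, fun n' hn' => ?_⟩
  obtain ⟨m, rfl⟩ := Nat.exists_eq_add_of_le hn'
  have h1 : p J * y (n + m) J ^ 2 ≤ secondMoment p (y (n + m)) J.length :=
    Finset.single_le_sum (f := fun J => p J * y (n + m) J ^ 2)
      (fun K _ => mul_nonneg (hp.pos K).le (sq_nonneg _)) (mem_words.2 rfl)
  have h2 : p J * y (n + m) J ^ 2 < p J * η ^ 2 :=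
    ((h1.trans (step n m _)).trans (hn _)).trans_lt hεη
  have h3 := lt_of_mul_lt_mul_left h2 (hp.pos J).le
  rw [Real.dist_eq, sub_zero]
  exact abs_lt_of_sq_lt_sq h3 hη.le

end Recurrence

/-- The average of a double sequence over the square `[0, N]²`. -/
noncomputable def squareAverage (u : ℕ → ℕ → ℝ) (N : ℕ) : ℝ :=
  ((N + 1 : ℝ) ^ 2)⁻¹ * ∑ a ∈ Finset.range (N + 1), ∑ b ∈ Finset.range (N + 1), u a b

theorem squareAverage_mono {u v : ℕ → ℕ → ℝ} (h : ∀ a b, u a b ≤ v a b) (N : ℕ) :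
    squareAverage u N ≤ squareAverage v N := by
  unfold squareAverage
  gcongr
  exact h _ _

theorem squareAverage_const (c : ℝ) (N : ℕ) : squareAverage (fun _ _ => c) N = c := by
  have : (N + 1 : ℝ) ≠ 0 := by positivity
  simp [squareAverage]
  field_simp

theorem squareAverage_sub_mul (u v : ℕ → ℕ → ℝ) (x y : ℝ) (N : ℕ) :
    squareAverage (fun a b => u a b * x - v a b * y) N =
      squareAverage u N * x - squareAverage v N * y := by
  simp only [squareAverage, Finset.sum_sub_distrib, ← Finset.sum_mul]
  ring

theorem squareAverage_sum {ι : Type*} (s : Finset ι) (u : ι → ℕ → ℕ → ℝ) (N : ℕ) :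
    squareAverage (fun a b => ∑ i ∈ s, u i a b) N = ∑ i ∈ s, squareAverage (u i) N := by
  simp only [squareAverage, ← Finset.mul_sum]
  congr 1
  exact (Finset.sum_congr rfl fun a _ => Finset.sum_comm).trans Finset.sum_comm

theorem squareAverage_swap (u : ℕ → ℕ → ℝ) (N : ℕ) :
    squareAverage (fun a b => u b a) N = squareAverage u N := by
  rw [squareAverage, squareAverage, Finset.sum_comm]

theorem tendsto_squareAverage_shift {u : ℕ → ℕ → ℝ} {C : ℝ} (hu : ∀ a b, |u a b| ≤ C) :
    Tendsto (fun N => squareAverage (fun a b => u a (b + 1)) N - squareAverage u N) atTop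
      (𝓝 0) := by
  have key : ∀ N : ℕ, squareAverage (fun a b => u a (b + 1)) N - squareAverage u N =
      ((N + 1 : ℝ) ^ 2)⁻¹ * ∑ a ∈ Finset.range (N + 1), (u a (N + 1) - u a 0) := by
    intro N
    simp only [squareAverage, ← mul_sub, ← Finset.sum_sub_distrib, Finset.sum_range_sub]
  refine squeeze_zero_norm (a := fun N : ℕ => 2 * C * (1 / ((N : ℝ) + 1))) (fun N => ?_) ?_
  · rw [key, Real.norm_eq_abs, abs_mul, abs_of_pos (by positivity)]
    have : |∑ a ∈ Finset.range (N + 1), (u a (N + 1) - u a 0)| ≤ (N + 1 : ℝ) * (2 * C) := by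
      refine (Finset.abs_sum_le_sum_abs _ _).trans ?_
      refine (Finset.sum_le_card_nsmul _ _ (2 * C) fun a _ => ?_).trans (by simp)
      linarith [abs_sub (u a (N + 1)) (u a 0), hu a (N + 1), hu a 0]
    calc ((N + 1 : ℝ) ^ 2)⁻¹ * _ ≤ ((N + 1 : ℝ) ^ 2)⁻¹ * ((N + 1 : ℝ) * (2 * C)) := by gcongr
      _ = _ := by field_simp
  · simpa using tendsto_one_div_add_atTop_nhds_zero_nat.const_mul (2 * C)

/-- The sum of `g` over all extensions of a word by `a` letters on the left and `b` letters on the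
right. -/
def extensionSum (g : List (Fin ℓ) → ℝ) (J : List (Fin ℓ)) (a b : ℕ) : ℝ :=
  ∑ K ∈ words ℓ a, ∑ L ∈ words ℓ b, g (K ++ J ++ L)

theorem extensionSum_right (g : List (Fin ℓ) → ℝ) (J : List (Fin ℓ)) (a b : ℕ) :
    extensionSum g J a (b + 1) = ∑ i, extensionSum g (J ++ [i]) a b := by
  simp only [extensionSum, sum_words_succ]
  simp [Finset.sum_comm (s := words ℓ a)]

theorem extensionSum_left (g : List (Fin ℓ) → ℝ) (J : List (Fin ℓ)) (a b : ℕ) :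
    extensionSum g J (a + 1) b = ∑ i, extensionSum g (i :: J) a b := by
  rw [extensionSum, sum_words_add a 1]
  simp only [sum_words_one, extensionSum]
  rw [Finset.sum_comm]
  simp

theorem extensionSum_eq {p : List (Fin ℓ) → ℝ} (hp : IsInvariantWeight p) (J : List (Fin ℓ))
    (a b : ℕ) : extensionSum p J a b = p J := by
  simp only [extensionSum, sum_append_right hp.right, sum_append_left hp.left]

theorem extensionSum_mono {f g : List (Fin ℓ) → ℝ} (h : ∀ I, f I ≤ g I) (J : List (Fin ℓ))
    (a b : ℕ) : extensionSum f J a b ≤ extensionSum g J a b :=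
  Finset.sum_le_sum fun _ _ => Finset.sum_le_sum fun _ _ => h _

theorem extensionSum_mul (f : List (Fin ℓ) → ℝ) (c : ℝ) (J : List (Fin ℓ)) (a b : ℕ) :
    extensionSum (fun I => c * f I) J a b = c * extensionSum f J a b := by
  simp only [extensionSum, Finset.mul_sum]

/-- A function comparable to an invariant weight has averaged extension sums that converge, along
a suitable ultrafilter, to a multiple of that weight. -/
theorem exists_tendsto_squareAverage {p : List (Fin ℓ) → ℝ} (hp : IsInvariantWeight p)
    {c : ℝ} (hc : 0 < c) {n₀ : ℕ}
    (hlow : ∀ I J, c * p I * p J ≤ ∑ K ∈ words ℓ n₀, p (I ++ K ++ J))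
    {g : List (Fin ℓ) → ℝ} {C₁ C₂ : ℝ} (hC₁ : 0 < C₁) (h₁ : ∀ I, C₁ * p I ≤ g I)
    (h₂ : ∀ I, g I ≤ C₂ * p I) :
    ∃ κ : ℝ, 0 < κ ∧ ∀ J, Tendsto (squareAverage (extensionSum g J)) (hyperfilter ℕ)
      (𝓝 (κ * p J)) := by
  have hb : ∀ J a b, extensionSum g J a b ∈ Set.Icc (C₁ * p J) (C₂ * p J) := by
    intro J a b
    rw [← extensionSum_eq hp J a b, ← extensionSum_mul, ← extensionSum_mul]
    exact ⟨extensionSum_mono h₁ J a b, extensionSum_mono h₂ J a b⟩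
  have hA : ∀ J N, squareAverage (extensionSum g J) N ∈ Set.Icc (C₁ * p J) (C₂ * p J) := by
    intro J N
    constructor
    · simpa only [squareAverage_const] using squareAverage_mono (fun a b => (hb J a b).1) N
    · simpa only [squareAverage_const] using squareAverage_mono (fun a b => (hb J a b).2) N
  have hlim : ∀ J, ∃ m ∈ Set.Icc (C₁ * p J) (C₂ * p J),
      Tendsto (squareAverage (extensionSum g J)) (hyperfilter ℕ) (𝓝 m) := by
    intro J
    have := isCompact_iff_ultrafilter_le_nhds.1 (isCompact_Icc (a := C₁ * p J) (b := C₂ * p J))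
      ((hyperfilter ℕ).map (squareAverage (extensionSum g J)))
      (by
        rw [le_principal_iff, Ultrafilter.coe_map, mem_map]
        exact Filter.univ_mem' (hA J))
    simpa [Tendsto] using this
  choose m hm hmlim using hlim
  have hU : (hyperfilter ℕ : Filter ℕ) ≤ atTop := Nat.hyperfilter_le_atTop
  have hbabs : ∀ J a b, |extensionSum g J a b| ≤ C₂ * p J := fun J a b => by
    rw [abs_of_nonneg ((mul_pos hC₁ (hp.pos J)).le.trans (hb J a b).1)]
    exact (hb J a b).2
  have hright : ∀ J, m J = ∑ i, m (J ++ [i]) := by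
    intro J
    have h0 := (tendsto_squareAverage_shift (hbabs J)).mono_left hU
    have e : (fun N => squareAverage (fun a b => extensionSum g J a (b + 1)) N) =
        fun N => ∑ i, squareAverage (extensionSum g (J ++ [i])) N := by
      ext N
      simp only [extensionSum_right, squareAverage_sum]
    have h1 := tendsto_finsetSum Finset.univ fun i _ => hmlim (J ++ [i])
    rw [← e] at h1
    have := tendsto_nhds_unique h0 (h1.sub (hmlim J))
    linarith
  have hleft : ∀ J, m J = ∑ i, m (i :: J) := by
    intro J
    have h0 := (tendsto_squareAverage_shift (u := fun a b => extensionSum g J b a)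
      (fun a b => hbabs J b a)).mono_left hU
    have e : (fun N => squareAverage (fun a b => extensionSum g J (b + 1) a) N) =
        fun N => ∑ i, squareAverage (extensionSum g (i :: J)) N := by
      ext N
      rw [squareAverage_swap fun a b => extensionSum g J (a + 1) b]
      simp only [extensionSum_left, squareAverage_sum]
    have h1 := tendsto_finsetSum Finset.univ fun i _ => hmlim (i :: J)
    rw [← e] at h1
    have e2 : squareAverage (fun a b => extensionSum g J b a) =
        squareAverage (extensionSum g J) := funext fun N => squareAverage_swap _ N
    rw [e2] at h0
    have := tendsto_nhds_unique h0 (h1.sub (hmlim J))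
    linarith
  have hκ : 0 < m [] := by
    have := (hm []).1
    rw [hp.nil] at this
    linarith
  have hmp : ∀ J, p J * (m J / p J - m []) = m J - p J * m [] := fun J => by
    have := (hp.pos J).ne'
    field_simp
  have hz := tendsto_zero_of_recurrent hp hc hlow (y := fun _ J => m J / p J - m [])
    (C := C₂ + m [])
    (fun n J => by
      have h3 : m J / p J ≤ C₂ := (div_le_iff₀ (hp.pos J)).2 (hm J).2
      have h4 : 0 ≤ m J / p J :=
        div_nonneg ((mul_pos hC₁ (hp.pos J)).le.trans (hm J).1) (hp.pos J).le
      rw [abs_le]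
      constructor <;> linarith [h3, h4])
    (fun n J => by
      simp only [hmp, Finset.sum_sub_distrib, ← Finset.sum_mul, ← hright, ← hp.right])
    (fun n J => by
      simp only [hmp, Finset.sum_sub_distrib, ← Finset.sum_mul, ← hleft, ← hp.left])
    (fun n => by simp [hp.nil])
    (fun ε hε => ⟨0, fun M => ⟨M, le_rfl, fun J => by simpa using hε.le⟩⟩)
  refine ⟨m [], hκ, fun J => ?_⟩
  have hJ := tendsto_nhds_unique (hz J) tendsto_const_nhds
  have : m J = m [] * p J := by
    have h5 := hmp J
    rw [← hJ] at h5
    linarith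
  rw [← this]
  exact hmlim J

theorem exists_net_of_comparable {p : List (Fin ℓ) → ℝ} (hp : IsInvariantWeight p)
    {c : ℝ} (hc : 0 < c) {n₀ : ℕ}
    (hlow : ∀ I J, c * p I * p J ≤ ∑ K ∈ words ℓ n₀, p (I ++ K ++ J))
    {g : List (Fin ℓ) → ℝ} {C₁ C₂ : ℝ} (hC₁ : 0 < C₁) (h₁ : ∀ I, C₁ * p I ≤ g I)
    (h₂ : ∀ I, g I ≤ C₂ * p I)
    (hg : ∀ ε : ℝ, 0 < ε → ∃ r : List (Fin ℓ) → List (Fin ℓ), (Set.range r).Finite ∧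
      ∀ K I L, |g (K ++ I ++ L) / p I - g (K ++ r I ++ L) / p (r I)| ≤ ε * p K * p L)
    (ε : ℝ) (hε : 0 < ε) : ∃ r : List (Fin ℓ) → List (Fin ℓ), (Set.range r).Finite ∧
      ∀ K I L, |p (K ++ I ++ L) / p I - p (K ++ r I ++ L) / p (r I)| ≤ ε * p K * p L := by
  obtain ⟨κ, hκ, hlim⟩ := exists_tendsto_squareAverage hp hc hlow hC₁ h₁ h₂
  obtain ⟨r, hr, h⟩ := hg (κ * ε) (by positivity)
  refine ⟨r, hr, fun K I L => ?_⟩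
  have hext : ∀ a b, |extensionSum g (K ++ I ++ L) a b * (p I)⁻¹ -
      extensionSum g (K ++ r I ++ L) a b * (p (r I))⁻¹| ≤ κ * ε * p K * p L := by
    intro a b
    simp only [extensionSum, Finset.sum_mul, ← Finset.sum_sub_distrib]
    calc _ ≤ ∑ K' ∈ words ℓ a, ∑ L' ∈ words ℓ b, κ * ε * p (K' ++ K) * p (L ++ L') := by
          refine (Finset.abs_sum_le_sum_abs _ _).trans (Finset.sum_le_sum fun K' _ => ?_)
          refine (Finset.abs_sum_le_sum_abs _ _).trans (Finset.sum_le_sum fun L' _ => ?_)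
          simpa [div_eq_mul_inv] using h (K' ++ K) I (L ++ L')
      _ = κ * ε * p K * p L := by
          simp only [← Finset.mul_sum, ← Finset.sum_mul, sum_append_right hp.right,
            sum_append_left hp.left]
  have hN : ∀ N, |squareAverage (extensionSum g (K ++ I ++ L)) N * (p I)⁻¹ -
      squareAverage (extensionSum g (K ++ r I ++ L)) N * (p (r I))⁻¹| ≤ κ * ε * p K * p L := by
    intro N
    rw [← squareAverage_sub_mul, abs_le]
    constructor
    · rw [← squareAverage_const (-_) N]
      exact squareAverage_mono (fun a b => (abs_le.1 (hext a b)).1) N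
    · rw [← squareAverage_const (κ * ε * p K * p L) N]
      exact squareAverage_mono (fun a b => (abs_le.1 (hext a b)).2) N
  have := le_of_tendsto (((hlim (K ++ I ++ L)).mul_const _).sub
    ((hlim (K ++ r I ++ L)).mul_const _)).abs (Eventually.of_forall hN)
  have e : κ * p (K ++ I ++ L) * (p I)⁻¹ - κ * p (K ++ r I ++ L) * (p (r I))⁻¹ =
      κ * (p (K ++ I ++ L) / p I - p (K ++ r I ++ L) / p (r I)) := by
    rw [div_eq_mul_inv, div_eq_mul_inv]; ring
  rw [e, abs_mul, abs_of_pos hκ, show κ * ε * p K * p L = κ * (ε * p K * p L) by ring] at this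
  exact le_of_mul_le_mul_left this hκ

/-- The ratio comparing the weight of all words with prefix `I`, suffix `J` and a gap of length `n`
with the product of the weights of `I` and `J`. -/
noncomputable def gapRatio (p : List (Fin ℓ) → ℝ) (n : ℕ) (I J : List (Fin ℓ)) : ℝ :=
  (∑ K ∈ words ℓ n, p (I ++ K ++ J)) / (p I * p J)

section GapRatio

variable {p : List (Fin ℓ) → ℝ}

theorem mul_gapRatio (hp : IsInvariantWeight p) (n : ℕ) (I J : List (Fin ℓ)) :
    p J * gapRatio p n I J = (∑ K ∈ words ℓ n, p (I ++ K ++ J)) / p I := by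
  have h1 := (hp.pos I).ne'
  have h2 := (hp.pos J).ne'
  rw [gapRatio]
  field_simp

theorem gapRatio_nonneg (hp : IsInvariantWeight p) (n : ℕ) (I J : List (Fin ℓ)) :
    0 ≤ gapRatio p n I J :=
  div_nonneg (Finset.sum_nonneg fun _ _ => (hp.pos _).le) (mul_pos (hp.pos _) (hp.pos _)).le

theorem gapRatio_le (hp : IsInvariantWeight p) {C : ℝ}
    (hC : ∀ I J, p (I ++ J) ≤ C * p I * p J) (n : ℕ) (I J : List (Fin ℓ)) :
    gapRatio p n I J ≤ C := by
  rw [gapRatio, div_le_iff₀ (mul_pos (hp.pos _) (hp.pos _))]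
  calc _ ≤ ∑ K ∈ words ℓ n, C * p I * p (K ++ J) :=
        Finset.sum_le_sum fun K _ => by simpa using hC I (K ++ J)
    _ = _ := by rw [← Finset.mul_sum, sum_append_left hp.left, mul_assoc]

theorem gapRatio_nil (hp : IsInvariantWeight p) (n : ℕ) (I : List (Fin ℓ)) :
    gapRatio p n I [] = 1 := by
  simp [gapRatio, sum_append_right hp.right, hp.nil, (hp.pos I).ne']

theorem gapRatio_right (hp : IsInvariantWeight p) (n : ℕ) (I J : List (Fin ℓ)) :
    p J * gapRatio p n I J = ∑ i, p (J ++ [i]) * gapRatio p n I (J ++ [i]) := by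
  simp only [mul_gapRatio hp, ← Finset.sum_div]
  rw [Finset.sum_comm]
  congr 1
  exact Finset.sum_congr rfl fun K _ => by simpa using hp.right (I ++ K ++ J)

theorem gapRatio_left (hp : IsInvariantWeight p) (n : ℕ) (I J : List (Fin ℓ)) :
    p J * gapRatio p (n + 1) I J = ∑ i, p (i :: J) * gapRatio p n I (i :: J) := by
  simp only [mul_gapRatio hp, ← Finset.sum_div]
  rw [Finset.sum_comm, sum_words_add n 1]
  simp [sum_words_one]

theorem abs_gapRatio_sub_left (hp : IsInvariantWeight p) {I I' : List (Fin ℓ)} {ε : ℝ}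
    (h : ∀ K L, |p (K ++ I ++ L) / p I - p (K ++ I' ++ L) / p I'| ≤ ε * p K * p L) (n : ℕ)
    (J : List (Fin ℓ)) : |gapRatio p n I J - gapRatio p n I' J| ≤ ε := by
  refine le_of_mul_le_mul_left ?_ (hp.pos J)
  rw [← abs_of_pos (hp.pos J), ← abs_mul, mul_sub, mul_gapRatio hp, mul_gapRatio hp,
    abs_of_pos (hp.pos J), Finset.sum_div, Finset.sum_div, ← Finset.sum_sub_distrib]
  calc _ ≤ ∑ K ∈ words ℓ n, ε * p (K ++ J) :=
        (Finset.abs_sum_le_sum_abs _ _).trans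
          (Finset.sum_le_sum fun K _ => by simpa [hp.nil] using h [] (K ++ J))
    _ = _ := by rw [← Finset.mul_sum, sum_append_left hp.left, mul_comm]

theorem abs_gapRatio_sub_right (hp : IsInvariantWeight p) {J J' : List (Fin ℓ)} {ε : ℝ}
    (h : ∀ K L, |p (K ++ J ++ L) / p J - p (K ++ J' ++ L) / p J'| ≤ ε * p K * p L) (n : ℕ)
    (I : List (Fin ℓ)) : |gapRatio p n I J - gapRatio p n I J'| ≤ ε := by
  refine le_of_mul_le_mul_left ?_ (hp.pos I)
  have e : ∀ J, p I * gapRatio p n I J = ∑ K ∈ words ℓ n, p (I ++ K ++ J) / p J := by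
    intro J
    have h1 := (hp.pos I).ne'
    have h2 := (hp.pos J).ne'
    rw [gapRatio, ← Finset.sum_div]
    field_simp
  rw [← abs_of_pos (hp.pos I), ← abs_mul, mul_sub, e, e, abs_of_pos (hp.pos I),
    ← Finset.sum_sub_distrib]
  calc _ ≤ ∑ K ∈ words ℓ n, ε * p (I ++ K) :=
        (Finset.abs_sum_le_sum_abs _ _).trans
          (Finset.sum_le_sum fun K _ => by simpa [hp.nil] using h (I ++ K) [])
    _ = _ := by rw [← Finset.mul_sum, sum_append_right hp.right, mul_comm]

theorem exists_recurrence (y : ℕ → List (Fin ℓ) → ℝ) {C : ℝ} (hC : ∀ n J, |y n J| ≤ C)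
    {ε : ℝ} (hε : 0 < ε) {r : List (Fin ℓ) → List (Fin ℓ)} (hr : (Set.range r).Finite)
    (h : ∀ n J, |y n J - y n (r J)| ≤ ε) :
    ∃ n, ∀ M, ∃ m ≥ M, ∀ J, |y (n + m) J - y n J| ≤ 3 * ε := by
  have : Fintype (Set.range r) := hr.fintype
  have hC0 : 0 ≤ C := (abs_nonneg _).trans (hC 0 [])
  obtain ⟨v, -, φ, hφ, hv⟩ := tendsto_subseq_of_bounded
    (Metric.isBounded_closedBall (x := (0 : Set.range r → ℝ)) (r := C))
    (x := fun n J => y n J.1) fun n => by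
      rw [mem_closedBall_zero_iff, pi_norm_le_iff_of_nonneg hC0]
      exact fun J => hC n J.1
  obtain ⟨k₀, hk⟩ := Metric.cauchySeq_iff'.1 hv.cauchySeq ε hε
  refine ⟨φ k₀, fun M => ?_⟩
  have h1 : φ k₀ + M + k₀ ≤ φ (φ k₀ + M + k₀) := hφ.id_le _
  refine ⟨φ (φ k₀ + M + k₀) - φ k₀, by omega, fun J => ?_⟩
  rw [Nat.add_sub_cancel' (by omega)]
  have h2 := (dist_le_pi_dist _ _ (⟨r J, J, rfl⟩ : Set.range r)).trans
    (hk (φ k₀ + M + k₀) (by omega)).le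
  rw [Real.dist_eq] at h2
  have h3 := h (φ (φ k₀ + M + k₀)) J
  have h4 := h (φ k₀) J
  simp only [Function.comp] at h2
  rw [abs_le] at *
  constructor <;> linarith

theorem gapRatio_uniform (hp : IsInvariantWeight p) {C : ℝ}
    (hC : ∀ I J, p (I ++ J) ≤ C * p I * p J) {c : ℝ} (hc : 0 < c) {n₀ : ℕ}
    (hlow : ∀ I J, c * p I * p J ≤ ∑ K ∈ words ℓ n₀, p (I ++ K ++ J))
    (hnet : ∀ ε : ℝ, 0 < ε → ∃ r : List (Fin ℓ) → List (Fin ℓ), (Set.range r).Finite ∧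
      ∀ K I L, |p (K ++ I ++ L) / p I - p (K ++ r I ++ L) / p (r I)| ≤ ε * p K * p L)
    (ε : ℝ) (hε : 0 < ε) :
    ∃ N, ∀ n ≥ N, ∀ I J, |gapRatio p n I J - 1| < ε := by
  have hbd : ∀ I n J, |gapRatio p n I J - 1| ≤ C + 1 := fun I n J => by
    have h1 := gapRatio_nonneg hp n I J
    have h2 := gapRatio_le hp hC n I J
    rw [abs_le]
    constructor <;> linarith
  have hpt : ∀ I J, Tendsto (fun n => gapRatio p n I J - 1) atTop (𝓝 0) := by
    intro I
    refine tendsto_zero_of_recurrent hp hc hlow (hbd I) (fun n J => ?_) (fun n J => ?_)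
      (fun n => by rw [gapRatio_nil hp, sub_self]) (fun ε hε => ?_)
    · simp only [mul_sub, Finset.sum_sub_distrib, ← gapRatio_right hp, mul_one, ← hp.right]
    · simp only [mul_sub, Finset.sum_sub_distrib, ← gapRatio_left hp, mul_one, ← hp.left]
    · obtain ⟨r, hr, h⟩ := hnet (ε / 3) (by positivity)
      have := exists_recurrence (fun n J => gapRatio p n I J - 1) (hbd I)
        (ε := ε / 3) (by positivity) hr fun n J => by
          simpa using abs_gapRatio_sub_right hp (fun K L => h K J L) n I
      simpa only [mul_div_cancel₀ ε (three_ne_zero)] using this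
  obtain ⟨r, hr, h⟩ := hnet (ε / 3) (by positivity)
  have hev : ∀ᶠ n in atTop, ∀ x ∈ Set.range r ×ˢ Set.range r,
      |gapRatio p n x.1 x.2 - 1| < ε / 3 := by
    rw [eventually_all_finite (hr.prod hr)]
    intro x _
    have := (hpt x.1 x.2).abs
    rw [abs_zero] at this
    exact this.eventually_lt_const (by positivity)
  obtain ⟨N, hN⟩ := eventually_atTop.1 hev
  refine ⟨N, fun n hn I J => ?_⟩
  have h1 := hN n hn (r I, r J) ⟨⟨I, rfl⟩, ⟨J, rfl⟩⟩
  have h2 := abs_gapRatio_sub_left hp (fun K L => h K I L) n J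
  have h3 := abs_gapRatio_sub_right hp (fun K L => h K J L) n (r I)
  rw [abs_lt] at *
  rw [abs_le] at h2 h3
  constructor <;> linarith [h1.1, h1.2, h2.1, h2.2, h3.1, h3.2]

end GapRatio

section Cylinder

theorem cylinder_nil : cylinder ([] : List (Fin ℓ)) = Set.univ := by
  ext x
  simp [_root_.cylinder]

theorem mem_cylinder_cons {i : Fin ℓ} {I : List (Fin ℓ)} {x : ℕ → Fin ℓ} :
    x ∈ cylinder (i :: I) ↔ x 0 = i ∧ shift ℓ x ∈ cylinder I := by
  simp [_root_.cylinder, shift, Fin.forall_fin_succ]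

theorem cylinder_cons (i : Fin ℓ) (I : List (Fin ℓ)) :
    cylinder (i :: I) = (fun x : ℕ → Fin ℓ => x 0) ⁻¹' {i} ∩ shift ℓ ⁻¹' cylinder I := by
  ext x
  exact mem_cylinder_cons

theorem cylinder_append (I J : List (Fin ℓ)) :
    cylinder (I ++ J) = cylinder I ∩ (shift ℓ)^[I.length] ⁻¹' cylinder J := by
  induction I with
  | nil => simp [cylinder_nil]
  | cons i I ih =>
    rw [List.cons_append, cylinder_cons, ih, cylinder_cons, Set.preimage_inter, Set.inter_assoc,
      List.length_cons, Function.iterate_succ, Set.preimage_comp]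

theorem measurable_shift : Measurable (shift ℓ) :=
  measurable_pi_lambda _ fun n => measurable_pi_apply (n + 1)

theorem measurableSet_cylinder (I : List (Fin ℓ)) : MeasurableSet (cylinder I) := by
  induction I with
  | nil => simp [cylinder_nil]
  | cons i I ih =>
    rw [cylinder_cons]
    exact (measurable_pi_apply 0 (measurableSet_singleton i)).inter (measurable_shift ih)

theorem measure_inter_preimage_eq_sum (μ : Measure (ℕ → Fin ℓ)) [IsFiniteMeasure μ]
    (I J : List (Fin ℓ)) (n : ℕ) :
    (μ (cylinder I ∩ (shift ℓ)^[n + I.length] ⁻¹' cylinder J)).toReal =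
      ∑ K ∈ words ℓ n, (μ (cylinder (I ++ K ++ J))).toReal := by
  induction n generalizing I with
  | zero => simp [sum_words_zero, cylinder_append, cylinder_nil]
  | succ n ih =>
    have hdec : cylinder I ∩ (shift ℓ)^[n + 1 + I.length] ⁻¹' cylinder J =
        ⋃ i, cylinder (I ++ [i]) ∩ (shift ℓ)^[n + (I ++ [i]).length] ⁻¹' cylinder J := by
      ext x
      simp only [Set.mem_iUnion, cylinder_append, Set.mem_inter_iff, Set.mem_preimage,
        mem_cylinder_cons, cylinder_nil, Set.mem_univ, List.length_append, List.length_singleton]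
      rw [show n + (I.length + 1) = n + 1 + I.length by ring]
      simp
    rw [hdec, measure_iUnion, tsum_fintype, ENNReal.toReal_sum (fun _ _ => measure_ne_top _ _),
      sum_words_succ]
    · exact Finset.sum_congr rfl fun i _ => by simpa using ih (I ++ [i])
    · intro i j hij
      refine Set.disjoint_left.2 fun x hx hy => hij ?_
      have h1 := hx.1
      have h2 := hy.1
      rw [cylinder_append, Set.mem_inter_iff, Set.mem_preimage, mem_cylinder_cons] at h1 h2
      exact h1.2.1.symm.trans h2.2.1
    · intro i
      exact (measurableSet_cylinder _).inter
        (measurable_shift.iterate _ (measurableSet_cylinder J))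

theorem isInvariantWeight_cylinder {μ : Measure (ℕ → Fin ℓ)} [IsProbabilityMeasure μ]
    (hinv : MeasurePreserving (shift ℓ) μ μ)
    (hpos : ∀ I : List (Fin ℓ), 0 < (μ (cylinder I)).toReal) :
    IsInvariantWeight fun I => (μ (cylinder I)).toReal where
  pos := hpos
  nil := by simp [cylinder_nil]
  left I := by
    have := measure_inter_preimage_eq_sum μ [] I 1
    simp only [cylinder_nil, Set.univ_inter, List.length_nil, add_zero, Function.iterate_one,
      sum_words_one, hinv.measure_preimage (measurableSet_cylinder I).nullMeasurableSet] at this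
    simpa using this
  right I := by
    have := measure_inter_preimage_eq_sum μ I [] 1
    simpa [cylinder_nil, sum_words_one] using this

end Cylinder

end Words

section Cocycle

open scoped Matrix.Norms.L2Operator

theorem opNorm_eq_norm (M : Matrix (Fin d) (Fin d) ℝ) : opNorm M = ‖M‖ := rfl

theorem wordProd_nil (A : Fin ℓ → Matrix (Fin d) (Fin d) ℝ) : wordProd A [] = 1 := rfl

theorem wordProd_append (A : Fin ℓ → Matrix (Fin d) (Fin d) ℝ) (I J : List (Fin ℓ)) :
    wordProd A (I ++ J) = wordProd A J * wordProd A I := by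
  have : ∀ (J : List (Fin ℓ)) (B : Matrix (Fin d) (Fin d) ℝ),
      J.foldl (fun B i => A i * B) B = wordProd A J * B := by
    intro J
    induction J with
    | nil => simp [wordProd]
    | cons j J ih =>
      intro B
      have h : wordProd A (j :: J) = J.foldl (fun B i => A i * B) (A j * 1) := rfl
      rw [List.foldl_cons, h, ih, ih]
      simp [Matrix.mul_assoc]
  rw [wordProd, List.foldl_append, this]
  rfl

theorem wordProd_singleton (A : Fin ℓ → Matrix (Fin d) (Fin d) ℝ) (i : Fin ℓ) :
    wordProd A [i] = A i := by
  simp [wordProd]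

theorem isUnit_wordProd {A : Fin ℓ → Matrix (Fin d) (Fin d) ℝ} (hA : ∀ i, IsUnit (A i))
    (I : List (Fin ℓ)) : IsUnit (wordProd A I) := by
  induction I using List.reverseRecOn with
  | nil => simp [wordProd_nil]
  | append_singleton I i ih =>
    rw [wordProd_append, wordProd_singleton]
    exact (hA i).mul ih

theorem norm_wordProd_pos (hd : 1 ≤ d) {A : Fin ℓ → Matrix (Fin d) (Fin d) ℝ}
    (hA : ∀ i, IsUnit (A i)) (I : List (Fin ℓ)) : 0 < ‖wordProd A I‖ := by
  have : Nonempty (Fin d) := ⟨⟨0, hd⟩⟩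
  exact norm_pos_iff.2 (isUnit_wordProd hA I).ne_zero

/-- The potential `‖A_I‖ ^ s`, normalised by the pressure `P`. -/
noncomputable def gibbsPotential (A : Fin ℓ → Matrix (Fin d) (Fin d) ℝ) (s P : ℝ)
    (I : List (Fin ℓ)) : ℝ :=
  Real.exp (-(I.length * P)) * ‖wordProd A I‖ ^ s

theorem gibbsPotential_pos (hd : 1 ≤ d) {A : Fin ℓ → Matrix (Fin d) (Fin d) ℝ}
    (hA : ∀ i, IsUnit (A i)) (s P : ℝ) (I : List (Fin ℓ)) : 0 < gibbsPotential A s P I :=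
  mul_pos (Real.exp_pos _) (Real.rpow_pos_of_pos (norm_wordProd_pos hd hA I) s)

theorem gibbsPotential_append_le (A : Fin ℓ → Matrix (Fin d) (Fin d) ℝ) {s : ℝ} (hs : 0 < s)
    (P : ℝ) (I J : List (Fin ℓ)) :
    gibbsPotential A s P (I ++ J) ≤ gibbsPotential A s P I * gibbsPotential A s P J := by
  have h1 : ‖wordProd A (I ++ J)‖ ^ s ≤ ‖wordProd A J‖ ^ s * ‖wordProd A I‖ ^ s := by
    rw [← Real.mul_rpow (norm_nonneg _) (norm_nonneg _), wordProd_append]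
    exact Real.rpow_le_rpow (norm_nonneg _) (norm_mul_le _ _) hs.le
  have h2 : Real.exp (-((I ++ J).length * P)) =
      Real.exp (-(I.length * P)) * Real.exp (-(J.length * P)) := by
    rw [← Real.exp_add, List.length_append]
    push_cast
    ring_nf
  calc gibbsPotential A s P (I ++ J) ≤ Real.exp (-(I.length * P)) * Real.exp (-(J.length * P)) *
        (‖wordProd A J‖ ^ s * ‖wordProd A I‖ ^ s) := by
        rw [gibbsPotential, h2]
        gcongr
    _ = _ := by rw [gibbsPotential, gibbsPotential]; ring

/-- A bounded family in a proper space can be retracted, up to a small error, onto finitely many of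
its members. -/
theorem exists_finite_range_dist_le {ι E : Type*} [PseudoMetricSpace E] [ProperSpace E]
    {X : ι → E} (hX : Bornology.IsBounded (Set.range X)) {δ : ℝ} (hδ : 0 < δ) :
    ∃ r : ι → ι, (Set.range r).Finite ∧ ∀ i, dist (X i) (X (r i)) < δ := by
  obtain ⟨t, ht, htf, hcov⟩ := Metric.finite_approx_of_totallyBounded
    (hX.isCompact_closure.totallyBounded.subset subset_closure) δ hδ
  have h1 : ∀ i, ∃ y ∈ t, dist (X i) y < δ := fun i => by
    simpa using hcov ⟨i, rfl⟩
  choose y hy hd using h1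
  choose f hf using fun z : t => ht z.2
  have := htf.to_subtype
  refine ⟨fun i => f ⟨y i, hy i⟩, (Set.finite_range f).subset ?_, fun i => ?_⟩
  · rintro _ ⟨i, rfl⟩
    exact ⟨_, rfl⟩
  · rw [hf]
    exact hd i

/-- The potential of `K ++ I ++ L`, divided by the weight of `I`, depends on `I` continuously
through a bounded family of matrices. -/
theorem exists_net_gibbsPotential (hd : 1 ≤ d) {A : Fin ℓ → Matrix (Fin d) (Fin d) ℝ}
    (hA : ∀ i, IsUnit (A i)) {s : ℝ} (hs : 0 < s) (P : ℝ) {p : List (Fin ℓ) → ℝ} {C₀ : ℝ}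
    (hC₀ : 0 < C₀) (hp : ∀ I, 0 < p I) (hg : ∀ I, gibbsPotential A s P I ≤ C₀ * p I)
    (ε : ℝ) (hε : 0 < ε) : ∃ r : List (Fin ℓ) → List (Fin ℓ), (Set.range r).Finite ∧
      ∀ K I L, |gibbsPotential A s P (K ++ I ++ L) / p I -
        gibbsPotential A s P (K ++ r I ++ L) / p (r I)| ≤ ε * p K * p L := by
  set g := gibbsPotential A s P with hgdef
  set t : List (Fin ℓ) → ℝ := fun I => (Real.exp (-(I.length * P)) / p I) ^ s⁻¹ with ht
  have htpos : ∀ I, 0 < t I := fun I =>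
    Real.rpow_pos_of_pos (div_pos (Real.exp_pos _) (hp I)) _
  have hts : ∀ I, t I ^ s = Real.exp (-(I.length * P)) / p I := fun I =>
    Real.rpow_inv_rpow (div_pos (Real.exp_pos _) (hp I)).le hs.ne'
  set X : List (Fin ℓ) → Matrix (Fin d) (Fin d) ℝ := fun I => t I • wordProd A I with hXdef
  set R : ℝ := C₀ ^ s⁻¹ with hR
  have hXn : ∀ I, ‖X I‖ ≤ R := by
    intro I
    rw [hR, Real.le_rpow_inv_iff_of_pos (norm_nonneg _) hC₀.le hs, hXdef]
    simp only
    rw [norm_smul, Real.norm_of_nonneg (htpos I).le, Real.mul_rpow (htpos I).le (norm_nonneg _),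
      hts, div_mul_eq_mul_div, div_le_iff₀ (hp I)]
    exact hg I
  have hunif : UniformContinuousOn (fun x : ℝ => x ^ s) (Set.Icc 0 R) :=
    isCompact_Icc.uniformContinuousOn_of_continuous
      (Real.continuous_rpow_const hs.le).continuousOn
  obtain ⟨δ, hδ, hu⟩ := Metric.uniformContinuousOn_iff.1 hunif (ε / C₀ ^ 2) (by positivity)
  obtain ⟨r, hr, hXr⟩ := exists_finite_range_dist_le (X := X)
    (Metric.isBounded_closedBall (x := 0) (r := R) |>.subset (by
      rintro _ ⟨I, rfl⟩
      simpa using hXn I)) hδ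
  refine ⟨r, hr, fun K I L => ?_⟩
  have hnorm : ∀ W, ‖‖wordProd A W‖⁻¹ • wordProd A W‖ = 1 := fun W => by
    rw [norm_smul, norm_inv, norm_norm, inv_mul_cancel₀ (norm_wordProd_pos hd hA W).ne']
  set U := ‖wordProd A L‖⁻¹ • wordProd A L with hU
  set V := ‖wordProd A K‖⁻¹ • wordProd A K with hV
  have hUV : ∀ Y, ‖U * Y * V‖ ≤ ‖Y‖ := fun Y => by
    calc ‖U * Y * V‖ ≤ ‖U‖ * ‖Y‖ * ‖V‖ := (norm_mul_le _ _).trans (by gcongr; exact norm_mul_le _ _)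
      _ = ‖Y‖ := by rw [hnorm, hnorm]; ring
  have key : ∀ I, g (K ++ I ++ L) / p I = g K * g L * ‖U * X I * V‖ ^ s := by
    intro I
    have e1 : U * X I * V = (‖wordProd A L‖⁻¹ * t I * ‖wordProd A K‖⁻¹) •
        wordProd A (K ++ I ++ L) := by
      simp only [hU, hV, hXdef, wordProd_append, smul_mul_assoc, mul_smul_comm, smul_smul,
        Matrix.mul_assoc]
      congr 1
      ring
    have e2 : Real.exp (-((K ++ I ++ L).length * P)) = Real.exp (-(K.length * P)) *
        Real.exp (-(I.length * P)) * Real.exp (-(L.length * P)) := by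
      rw [← Real.exp_add, ← Real.exp_add]
      simp only [List.length_append]
      push_cast
      ring_nf
    have h1 := norm_wordProd_pos hd hA L
    have h2 := norm_wordProd_pos hd hA K
    have h3 := htpos I
    rw [e1, norm_smul, Real.norm_of_nonneg (by positivity), Real.mul_rpow (by positivity)
      (norm_nonneg _), Real.mul_rpow (by positivity) (by positivity),
      Real.mul_rpow (by positivity) (by positivity), hts, Real.inv_rpow (by positivity),
      Real.inv_rpow (by positivity)]
    have h4 := Real.rpow_pos_of_pos h1 s
    have h5 := Real.rpow_pos_of_pos h2 s
    have h6 := hp I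
    simp only [hgdef, gibbsPotential, e2]
    field_simp
  have hgp : ∀ W, 0 < g W := gibbsPotential_pos hd hA s P
  have hdist : |‖U * X I * V‖ ^ s - ‖U * X (r I) * V‖ ^ s| < ε / C₀ ^ 2 := by
    rw [← Real.dist_eq]
    refine hu _ ⟨norm_nonneg _, (hUV _).trans (hXn _)⟩ _ ⟨norm_nonneg _, (hUV _).trans (hXn _)⟩ ?_
    refine (dist_norm_norm_le _ _).trans_lt ?_
    rw [← sub_mul, ← mul_sub]
    exact (hUV _).trans_lt (by simpa [dist_eq_norm] using hXr I)
  rw [key, key, ← mul_sub, abs_mul, abs_of_pos (mul_pos (hgp K) (hgp L))]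
  calc _ ≤ (C₀ * p K * (C₀ * p L)) * (ε / C₀ ^ 2) := by
        have h7 := hgp L
        have h8 := hp K
        have h9 := hp L
        gcongr
        · exact hg K
        · exact hg L
    _ = _ := by field_simp

theorem wordProd_cons (A : Fin ℓ → Matrix (Fin d) (Fin d) ℝ) (i : Fin ℓ) (I : List (Fin ℓ)) :
    wordProd A (i :: I) = wordProd A I * A i := by
  rw [← List.singleton_append, wordProd_append, wordProd_singleton]

/-- If `W * π` has at least the rank of `π`, the two have the same kernel. -/
theorem mul_eq_zero_of_rank_le {π W M : Matrix (Fin d) (Fin d) ℝ} (h : π.rank ≤ (W * π).rank)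
    (hM : W * π * M = 0) : π * M = 0 := by
  have hle : LinearMap.ker π.mulVecLin ≤ LinearMap.ker (W * π).mulVecLin := by
    intro v hv
    simp only [LinearMap.mem_ker, Matrix.mulVecLin_apply] at hv ⊢
    rw [← Matrix.mulVec_mulVec, hv, Matrix.mulVec_zero]
  have h1 := π.mulVecLin.finrank_range_add_finrank_ker
  have h2 := (W * π).mulVecLin.finrank_range_add_finrank_ker
  have heq := Submodule.eq_of_le_of_finrank_le hle (by
    rw [Matrix.rank, Matrix.rank] at h
    omega)
  refine Matrix.toLin'.injective (LinearMap.ext fun v => ?_)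
  have hv : M *ᵥ v ∈ LinearMap.ker (W * π).mulVecLin := by
    rw [LinearMap.mem_ker, Matrix.mulVecLin_apply, Matrix.mulVec_mulVec, hM, Matrix.zero_mulVec]
  rw [← heq, LinearMap.mem_ker, Matrix.mulVecLin_apply, Matrix.mulVec_mulVec] at hv
  simpa using hv

theorem mul_eq_zero_of_rank_le' {π W M : Matrix (Fin d) (Fin d) ℝ} (h : π.rank ≤ (π * W).rank)
    (hM : M * (π * W) = 0) : M * π = 0 := by
  have h1 : πᵀ * Mᵀ = 0 := by
    refine mul_eq_zero_of_rank_le (W := Wᵀ) ?_ ?_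
    · rw [← Matrix.transpose_mul, Matrix.rank_transpose, Matrix.rank_transpose]
      exact h
    · rw [← Matrix.transpose_mul, ← Matrix.transpose_mul, hM, Matrix.transpose_zero]
  rw [← Matrix.transpose_mul] at h1
  simpa using congrArg Matrix.transpose h1

section Irreducible

variable {A : Fin ℓ → Matrix (Fin d) (Fin d) ℝ}

/-- No nontrivial subspace is invariant under all the matrices `A i`. -/
def IsIrreducibleCocycle (A : Fin ℓ → Matrix (Fin d) (Fin d) ℝ) : Prop :=
  ∀ V : Submodule ℝ (Fin d → ℝ), (∀ i, ∀ x ∈ V, A i *ᵥ x ∈ V) → V = ⊥ ∨ V = ⊤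

theorem IsIrreducibleCocycle.eq_zero (hA : IsIrreducibleCocycle A)
    {Y : Matrix (Fin d) (Fin d) ℝ} (hY : Y ≠ 0) {x : Fin d → ℝ}
    (hx : ∀ K, (Y * wordProd A K) *ᵥ x = 0) : x = 0 := by
  let V : Submodule ℝ (Fin d → ℝ) :=
    { carrier := {x | ∀ K, (Y * wordProd A K) *ᵥ x = 0}
      add_mem' := fun ha hb K => by rw [Matrix.mulVec_add, ha K, hb K, add_zero]
      zero_mem' := fun K => Matrix.mulVec_zero _
      smul_mem' := fun c x h K => by rw [Matrix.mulVec_smul, h K, smul_zero] }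
  rcases hA V fun i x h K => by
    rw [Matrix.mulVec_mulVec, Matrix.mul_assoc, ← wordProd_cons]
    exact h (i :: K) with h | h
  · have : x ∈ V := hx
    simpa [h] using this
  · refine absurd (Matrix.toLin'.injective (LinearMap.ext fun v => ?_)) hY
    have : v ∈ V := h ▸ Submodule.mem_top
    simpa [wordProd_nil] using this []

theorem IsIrreducibleCocycle.exists_mul_ne_zero (hA : IsIrreducibleCocycle A)
    {X Y : Matrix (Fin d) (Fin d) ℝ} (hY : Y ≠ 0) (hX : X ≠ 0) :
    ∃ K, Y * wordProd A K * X ≠ 0 := by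
  by_contra! h
  refine hX (Matrix.toLin'.injective (LinearMap.ext fun v => ?_))
  simp only [Matrix.toLin'_apply, map_zero, LinearMap.zero_apply]
  refine hA.eq_zero hY fun K => ?_
  rw [Matrix.mulVec_mulVec, h K, Matrix.zero_mulVec]

/-- Irreducibility of all the powers `𝒜^t`, for `t` a divisor of `d`, rules out periodicity of the
return times of a nonzero matrix. -/
theorem not_periodic (hirr : ∀ t : ℕ, 0 < t → t ∣ d →
      ¬ ∃ V : Submodule ℝ (Fin d → ℝ), V ≠ ⊥ ∧ V ≠ ⊤ ∧
        ∀ I : List (Fin ℓ), I.length = t → V.map (wordProd A I).mulVecLin ≤ V)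
    (hirr₁ : IsIrreducibleCocycle A) {i₀ : Fin ℓ} (hA : IsUnit (A i₀))
    {π : Matrix (Fin d) (Fin d) ℝ} (hπ : π ≠ 0) {k : ℕ} (hk : 2 ≤ k) (s₀ : ZMod k)
    (h : ∀ K, π * wordProd A K * π ≠ 0 → (K.length : ZMod k) = s₀) : False := by
  have : NeZero k := ⟨by omega⟩
  have : DecidableEq (ZMod k) := Classical.decEq _
  let Z (T : ZMod k → Prop) : Submodule ℝ (Fin d → ℝ) :=
    { carrier := {x | ∀ K : List (Fin ℓ), T (K.length : ZMod k) → (π * wordProd A K) *ᵥ x = 0}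
      add_mem' := fun ha hb K hK => by rw [Matrix.mulVec_add, ha K hK, hb K hK, add_zero]
      zero_mem' := fun K _ => Matrix.mulVec_zero _
      smul_mem' := fun c x h K hK => by rw [Matrix.mulVec_smul, h K hK, smul_zero] }
  let Y (a : ZMod k) : Submodule ℝ (Fin d → ℝ) := Z fun j => j + a ≠ s₀
  have hstep : ∀ a i, ∀ x ∈ Y a, A i *ᵥ x ∈ Y (a + 1) := by
    intro a i x hx K hK
    rw [Matrix.mulVec_mulVec, Matrix.mul_assoc, ← wordProd_cons]
    refine hx (i :: K) ?_
    rw [List.length_cons]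
    push_cast
    rwa [add_right_comm, add_assoc]
  have hword : ∀ (I : List (Fin ℓ)) a, ∀ x ∈ Y a, wordProd A I *ᵥ x ∈ Y (a + I.length) := by
    intro I
    induction I with
    | nil => intro a x hx; simpa [wordProd_nil] using hx
    | cons i I ih =>
      intro a x hx
      have := ih (a + 1) _ (hstep a i x hx)
      rw [Matrix.mulVec_mulVec, ← wordProd_cons] at this
      rw [List.length_cons]
      push_cast
      rwa [add_comm (I.length : ZMod k), ← add_assoc]
  have hindep : iSupIndep Y := by
    intro a
    rw [Submodule.disjoint_def]
    intro x hx hx'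
    have hle : (⨆ b, ⨆ (_ : b ≠ a), Y b) ≤ Z fun j => j + a = s₀ := by
      refine iSup₂_le fun b hb x hx K hK => hx K fun h' => hb ?_
      exact add_left_cancel (h'.trans hK.symm)
    refine hirr₁.eq_zero hπ fun K => ?_
    by_cases hK : (K.length : ZMod k) + a = s₀
    · exact hle hx' K hK
    · exact hx K hK
  have hrange : ∀ v, π *ᵥ v ∈ Y 0 := by
    intro v K hK
    rw [Matrix.mulVec_mulVec]
    have : π * wordProd A K * π = 0 := by
      by_contra hne
      exact hK (by rw [add_zero]; exact h K hne)
    rw [this, Matrix.zero_mulVec]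
  have hY0 : Y 0 ≠ ⊥ := by
    intro h0
    refine hπ (Matrix.toLin'.injective (LinearMap.ext fun v => ?_))
    have := hrange v
    rw [h0, Submodule.mem_bot] at this
    simpa using this
  have htop : iSup Y = ⊤ := by
    refine (hirr₁ (iSup Y) fun i x hx => ?_).resolve_left fun hb => hY0 ?_
    · have : iSup Y ≤ (iSup Y).comap (A i).mulVecLin :=
        iSup_le fun a x hx => Submodule.mem_iSup_of_mem (a + 1) (hstep a i x hx)
      exact this hx
    · rw [eq_bot_iff, ← hb]
      exact le_iSup Y 0
  have hmono : ∀ a, Module.finrank ℝ (Y a) ≤ Module.finrank ℝ (Y (a + 1)) := by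
    intro a
    have hinj : Function.Injective (A i₀).mulVecLin := Matrix.mulVec_injective_of_isUnit hA
    rw [(Submodule.equivMapOfInjective _ hinj (Y a)).finrank_eq]
    refine Submodule.finrank_mono ?_
    rintro _ ⟨x, hx, rfl⟩
    exact hstep a i₀ x hx
  have hmono' : ∀ (n : ℕ) (a b : ZMod k), b = a + n → Module.finrank ℝ (Y a) ≤ Module.finrank ℝ (Y b) := by
    intro n
    induction n with
    | zero =>
      rintro a b rfl
      rw [Nat.cast_zero, add_zero]
    | succ n ih =>
      rintro a b rfl
      refine (ih a _ rfl).trans ((hmono _).trans (le_of_eq ?_))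
      rw [Nat.cast_succ, add_assoc]
  have hconst : ∀ a, Module.finrank ℝ (Y a) = Module.finrank ℝ (Y 0) := fun a =>
    le_antisymm (hmono' (-a).val _ _ (by simp)) (hmono' a.val _ _ (by simp))
  have hint := DirectSum.isInternal_submodule_of_iSupIndep_of_iSup_eq_top hindep htop
  have hdim : d = k * Module.finrank ℝ (Y 0) := by
    have := Module.finrank_eq_card_basis
      (hint.collectedBasis fun a => Module.finBasis ℝ (Y a))
    rw [Module.finrank_fin_fun, Fintype.card_sigma] at this
    simpa [hconst, ZMod.card] using this
  have hpos : 0 < Module.finrank ℝ (Y 0) := by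
    rw [pos_iff_ne_zero, Ne, Submodule.finrank_eq_zero]
    exact hY0
  refine hirr k (by omega) ⟨_, hdim⟩ ⟨Y 0, hY0, fun ht => ?_, fun I hI => ?_⟩
  · rw [ht, finrank_top, Module.finrank_fin_fun] at hdim hpos
    nlinarith
  · rintro _ ⟨x, hx, rfl⟩
    simpa [hI] using hword I 0 x hx

end Irreducible

/-- A set of natural numbers closed under addition up to common shifts is either contained in a
single residue class or contains arbitrarily long intervals. -/
theorem exists_interval_subset {S : Set ℕ} (hS : S.Nonempty)
    (hadd : ∀ N : Finset ℕ, ↑N ⊆ S → ∃ p, ∀ a ∈ N, ∀ b ∈ N, a + b + p ∈ S)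
    (hper : ∀ k : ℕ, 2 ≤ k → ¬ ∃ s : ZMod k, ∀ n ∈ S, (n : ZMod k) = s) (j : ℕ) :
    ∃ a, ∀ i ≤ j, a + i ∈ S := by
  obtain ⟨n₀, hn₀⟩ := hS
  let D : AddSubgroup ℤ := AddSubgroup.ofSub {z | ∃ a ∈ S, ∃ b ∈ S, z = (a : ℤ) - b}
    ⟨0, n₀, hn₀, n₀, hn₀, by simp⟩ (by
      rintro _ ⟨a, ha, b, hb, rfl⟩ _ ⟨a', ha', b', hb', rfl⟩
      obtain ⟨p, hp⟩ := hadd {a, b, a', b'} (by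
        intro x hx
        simp only [Finset.coe_insert, Finset.coe_singleton, Set.mem_insert_iff,
          Set.mem_singleton_iff] at hx
        rcases hx with rfl | rfl | rfl | rfl <;> assumption)
      refine ⟨a + b' + p, hp _ (by simp) _ (by simp), b + a' + p, hp _ (by simp) _ (by simp), ?_⟩
      push_cast
      ring)
  have hone : (1 : ℤ) ∈ D := by
    obtain ⟨g, hg⟩ := Int.subgroup_cyclic D
    have hdvd : ∀ z ∈ D, g ∣ z := fun z hz => by
      rw [hg, AddSubgroup.mem_closure_singleton] at hz
      obtain ⟨m, rfl⟩ := hz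
      exact ⟨m, by simp [mul_comm]⟩
    by_cases h1 : g.natAbs = 1
    · have : g ∈ D := hg ▸ AddSubgroup.subset_closure rfl
      rcases Int.natAbs_eq g with h | h <;> rw [h1] at h
      · simpa [h] using this
      · simpa [h] using this
    · exfalso
      obtain ⟨k, hk, hkg⟩ : ∃ k : ℕ, 2 ≤ k ∧ (k : ℤ) ∣ g := by
        by_cases h0 : g = 0
        · exact ⟨2, le_rfl, h0 ▸ dvd_zero _⟩
        · exact ⟨g.natAbs, by omega, Int.natAbs_dvd.2 dvd_rfl⟩
      refine hper k hk ⟨n₀, fun n hn => ?_⟩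
      have := hkg.trans (hdvd (n - n₀) ⟨n, hn, n₀, hn₀, rfl⟩)
      rw [← ZMod.intCast_zmod_eq_zero_iff_dvd] at this
      push_cast at this
      exact sub_eq_zero.1 this
  obtain ⟨m', hm', m, hm, hmm⟩ := hone
  have hm1 : m + 1 ∈ S := by
    have : m' = m + 1 := by omega
    exact this ▸ hm'
  induction j with
  | zero => exact ⟨n₀, fun i hi => by simpa [Nat.le_zero.1 hi] using hn₀⟩
  | succ j ih =>
    obtain ⟨a, ha⟩ := ih
    obtain ⟨p, hp⟩ := hadd (insert m (insert (m + 1) ((Finset.range (j + 1)).image (a + ·)))) (by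
      intro x hx
      simp only [Finset.coe_insert, Finset.coe_image, Set.mem_insert_iff, Set.mem_image,
        Finset.coe_range, Set.mem_Iio] at hx
      rcases hx with rfl | rfl | ⟨i, hi, rfl⟩
      · exact hm
      · exact hm1
      · exact ha i (by omega))
    refine ⟨a + m + p, fun i hi => ?_⟩
    rcases Nat.lt_or_ge j i with h | h
    · have := hp (a + j) (by simp) (m + 1) (by simp)
      have e : i = j + 1 := by omega
      rw [e]
      convert this using 1
      ring
    · have := hp (a + i) (by
        simp only [Finset.mem_insert, Finset.mem_image, Finset.mem_range]
        exact Or.inr (Or.inr ⟨i, by omega, rfl⟩)) m (by simp)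
      convert this using 1
      ring

/-- The set of all scalar multiples of products of the cocycle. -/
def scaledProducts (A : Fin ℓ → Matrix (Fin d) (Fin d) ℝ) : Set (Matrix (Fin d) (Fin d) ℝ) :=
  {X | ∃ (c : ℝ) (I : List (Fin ℓ)), X = c • wordProd A I}

theorem smul_wordProd_mem_closure (A : Fin ℓ → Matrix (Fin d) (Fin d) ℝ) (c : ℝ)
    (I : List (Fin ℓ)) : c • wordProd A I ∈ closure (scaledProducts A) :=
  subset_closure ⟨c, I, rfl⟩

theorem wordProd_mem_closure (A : Fin ℓ → Matrix (Fin d) (Fin d) ℝ) (I : List (Fin ℓ)) :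
    wordProd A I ∈ closure (scaledProducts A) :=
  subset_closure ⟨1, I, (one_smul _ _).symm⟩

theorem mul_mem_closure_scaledProducts {A : Fin ℓ → Matrix (Fin d) (Fin d) ℝ}
    {X Y : Matrix (Fin d) (Fin d) ℝ} (hX : X ∈ closure (scaledProducts A))
    (hY : Y ∈ closure (scaledProducts A)) : X * Y ∈ closure (scaledProducts A) := by
  refine map_mem_closure₂ continuous_mul hX hY ?_
  rintro _ ⟨c, I, rfl⟩ _ ⟨c', I', rfl⟩
  exact ⟨c * c', I' ++ I, by rw [smul_mul_smul_comm, wordProd_append]⟩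

/-- A bound on the length of connecting words that is uniform over pairs of nonzero matrices. -/
theorem IsIrreducibleCocycle.exists_length_le {A : Fin ℓ → Matrix (Fin d) (Fin d) ℝ}
    (hA : IsIrreducibleCocycle A) :
    ∃ D, ∀ X Y : Matrix (Fin d) (Fin d) ℝ, Y ≠ 0 → X ≠ 0 →
      ∃ K : List (Fin ℓ), K.length ≤ D ∧ Y * wordProd A K * X ≠ 0 := by
  have hne : ∀ x ∈ Metric.sphere (0 : Matrix (Fin d) (Fin d) ℝ) 1, x ≠ 0 := by
    rintro x hx rfl
    simp at hx
  obtain ⟨D, hD⟩ := ((isCompact_sphere (0 : Matrix (Fin d) (Fin d) ℝ) 1).prod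
    (isCompact_sphere (0 : Matrix (Fin d) (Fin d) ℝ) 1)).elim_directed_cover
    (fun D : ℕ => ⋃ K : List (Fin ℓ), ⋃ _ : K.length ≤ D,
      {x : Matrix (Fin d) (Fin d) ℝ × Matrix (Fin d) (Fin d) ℝ | x.2 * wordProd A K * x.1 ≠ 0})
    (fun D => isOpen_iUnion fun K => isOpen_iUnion fun _ =>
      isOpen_ne_fun (by fun_prop) continuous_const)
    (fun x hx => by
      obtain ⟨K, hK⟩ := hA.exists_mul_ne_zero (hne _ hx.2) (hne _ hx.1)
      exact Set.mem_iUnion.2 ⟨K.length, Set.mem_iUnion₂.2 ⟨K, le_rfl, hK⟩⟩)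
    (directed_of_isDirected_le fun a b hab => Set.iUnion_mono fun K =>
      Set.iUnion_mono' fun h => ⟨h.trans hab, subset_rfl⟩)
  refine ⟨D, fun X Y hY hX => ?_⟩
  have hsph : ∀ Z : Matrix (Fin d) (Fin d) ℝ, Z ≠ 0 → ‖Z‖⁻¹ • Z ∈ Metric.sphere 0 1 := by
    intro Z hZ
    rw [mem_sphere_zero_iff_norm, norm_smul, norm_inv, norm_norm,
      inv_mul_cancel₀ (norm_ne_zero_iff.2 hZ)]
  have := @hD (‖X‖⁻¹ • X, ‖Y‖⁻¹ • Y) ⟨hsph X hX, hsph Y hY⟩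
  obtain ⟨K, hK, h⟩ := Set.mem_iUnion₂.1 this
  refine ⟨K, hK, fun h0 => h ?_⟩
  simp [h0]

/-- A nonzero limit of scaled products, of minimal rank. -/
structure IsMinimalRankLimit (A : Fin ℓ → Matrix (Fin d) (Fin d) ℝ)
    (π : Matrix (Fin d) (Fin d) ℝ) : Prop where
  mem : π ∈ closure (scaledProducts A)
  ne_zero : π ≠ 0
  rank_le : ∀ X ∈ closure (scaledProducts A), X ≠ 0 → π.rank ≤ X.rank

theorem exists_isMinimalRankLimit (hd : 1 ≤ d) (A : Fin ℓ → Matrix (Fin d) (Fin d) ℝ) :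
    ∃ π, IsMinimalRankLimit A π := by
  have : Nonempty (Fin d) := ⟨⟨0, hd⟩⟩
  obtain ⟨π, ⟨h1, h2⟩, h3⟩ := (measure (Matrix.rank (R := ℝ) (m := Fin d) (n := Fin d))).wf.has_min
    {X | X ∈ closure (scaledProducts A) ∧ X ≠ 0} ⟨1, wordProd_mem_closure A [], one_ne_zero⟩
  exact ⟨π, h1, h2, fun X hX hX0 => not_lt.1 (h3 X ⟨hX, hX0⟩)⟩

namespace IsMinimalRankLimit

variable {A : Fin ℓ → Matrix (Fin d) (Fin d) ℝ} {π : Matrix (Fin d) (Fin d) ℝ}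

theorem mul_mul_ne_zero (hπ : IsMinimalRankLimit A π) {X Y : Matrix (Fin d) (Fin d) ℝ}
    (hX : X ∈ closure (scaledProducts A)) (hY : Y ∈ closure (scaledProducts A))
    {K L₁ L₂ : List (Fin ℓ)} (h₁ : Y * wordProd A L₁ * π ≠ 0) (h₂ : π * wordProd A L₂ * X ≠ 0)
    (h : π * wordProd A K * π ≠ 0) :
    Y * wordProd A L₁ * π * wordProd A K * π * wordProd A L₂ * X ≠ 0 := by
  intro h0
  have hW := wordProd_mem_closure A
  have e₁ : wordProd A K * π * wordProd A L₂ * X = wordProd A K * (π * (wordProd A L₂ * X)) := by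
    simp only [Matrix.mul_assoc]
  have h3 : π * (wordProd A K * (π * (wordProd A L₂ * X))) = 0 := by
    refine mul_eq_zero_of_rank_le (W := Y * wordProd A L₁) (hπ.rank_le _ ?_ h₁) ?_
    · exact mul_mem_closure_scaledProducts (mul_mem_closure_scaledProducts hY (hW _)) hπ.mem
    · simpa only [Matrix.mul_assoc] using h0
  refine h (mul_eq_zero_of_rank_le' (W := wordProd A L₂ * X) (hπ.rank_le _ ?_ ?_) ?_)
  · exact mul_mem_closure_scaledProducts hπ.mem (mul_mem_closure_scaledProducts (hW _) hX)
  · simpa only [Matrix.mul_assoc] using h₂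
  · simpa only [Matrix.mul_assoc] using h3

theorem exists_common_shift (hπ : IsMinimalRankLimit A π) (N : Finset ℕ)
    (hN : ↑N ⊆ {n | ∃ K : List (Fin ℓ), K.length = n ∧ π * wordProd A K * π ≠ 0}) :
    ∃ p, ∀ a ∈ N, ∀ b ∈ N,
      a + b + p ∈ {n | ∃ K : List (Fin ℓ), K.length = n ∧ π * wordProd A K * π ≠ 0} := by
  choose! K hKl hK using fun a (ha : a ∈ N) => hN (Finset.mem_coe.2 ha)
  have hev : ∀ᶠ R in 𝓝 π, ∀ a ∈ N, ∀ b ∈ N,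
      π * wordProd A (K a) * R * wordProd A (K b) * π ≠ 0 := by
    rw [Filter.eventually_all_finset]
    intro a ha
    rw [Filter.eventually_all_finset]
    intro b hb
    have hc : Continuous fun R => π * wordProd A (K a) * R * wordProd A (K b) * π := by fun_prop
    refine hc.continuousAt.eventually_ne fun h0 => hK b hb ?_
    have := mul_eq_zero_of_rank_le (W := π * wordProd A (K a)) (M := wordProd A (K b) * π)
      (hπ.rank_le _ (mul_mem_closure_scaledProducts (mul_mem_closure_scaledProducts hπ.mem
        (wordProd_mem_closure A _)) hπ.mem) (hK a ha)) (by simpa only [Matrix.mul_assoc] using h0)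
    simpa only [Matrix.mul_assoc] using this
  obtain ⟨_, hR, c, I, rfl⟩ := ((mem_closure_iff_frequently.1 hπ.mem).and_eventually hev).exists.imp
    fun R h => And.intro h.2 h.1
  refine ⟨I.length, fun a ha b hb => ⟨K b ++ I ++ K a, ?_, fun h0 => hR a ha b hb ?_⟩⟩
  · simp only [List.length_append, hKl a ha, hKl b hb]
    ring
  · rw [wordProd_append, wordProd_append] at h0
    simp only [mul_smul_comm, smul_mul_assoc]
    rw [show π * wordProd A (K a) * wordProd A I * wordProd A (K b) * π = 0 by
      simpa only [Matrix.mul_assoc] using h0, smul_zero]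

end IsMinimalRankLimit

/-- Connecting words of one fixed length for all pairs of unit scaled products. -/
theorem exists_uniform_connecting_length (hd : 1 ≤ d) {A : Fin ℓ → Matrix (Fin d) (Fin d) ℝ}
    (hirr : ∀ t : ℕ, 0 < t → t ∣ d →
      ¬ ∃ V : Submodule ℝ (Fin d → ℝ), V ≠ ⊥ ∧ V ≠ ⊤ ∧
        ∀ I : List (Fin ℓ), I.length = t → V.map (wordProd A I).mulVecLin ≤ V)
    (hirr₁ : IsIrreducibleCocycle A) {i₀ : Fin ℓ} (hA : IsUnit (A i₀)) :
    ∃ n₀, ∀ X ∈ closure (scaledProducts A) ∩ Metric.sphere 0 1,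
      ∀ Y ∈ closure (scaledProducts A) ∩ Metric.sphere 0 1,
        ∃ K : List (Fin ℓ), K.length = n₀ ∧ Y * wordProd A K * X ≠ 0 := by
  obtain ⟨π, hπ⟩ := exists_isMinimalRankLimit hd A
  obtain ⟨D, hD⟩ := hirr₁.exists_length_le
  obtain ⟨a, ha⟩ := exists_interval_subset
    (S := {n | ∃ K : List (Fin ℓ), K.length = n ∧ π * wordProd A K * π ≠ 0})
    (by
      obtain ⟨K, hK⟩ := hirr₁.exists_mul_ne_zero hπ.ne_zero hπ.ne_zero
      exact ⟨_, K, rfl, hK⟩)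
    hπ.exists_common_shift
    (by
      rintro k hk ⟨s, hs⟩
      exact not_periodic hirr hirr₁ hA hπ.ne_zero hk s fun K hK => hs _ ⟨K, rfl, hK⟩)
    (2 * D)
  set M := a + 2 * D with hM
  set T := closure (scaledProducts A) ∩ Metric.sphere 0 1 with hT
  have hTc : IsCompact T := (isCompact_sphere _ _).inter_left isClosed_closure
  have hT0 : ∀ X ∈ T, X ≠ 0 := by
    rintro X hX rfl
    simpa using hX.2
  let O : Set ((Matrix (Fin d) (Fin d) ℝ × Matrix (Fin d) (Fin d) ℝ) × Matrix (Fin d) (Fin d) ℝ) :=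
    ⋃ K₁ : List (Fin ℓ), ⋃ K₂ : List (Fin ℓ), ⋃ K₃ : List (Fin ℓ),
      ⋃ _ : K₁.length + K₂.length + K₃.length = M,
        {x | x.1.2 * wordProd A K₁ * x.2 * wordProd A K₂ * x.2 * wordProd A K₃ * x.1.1 ≠ 0}
  have hO : IsOpen O := isOpen_iUnion fun _ => isOpen_iUnion fun _ => isOpen_iUnion fun _ =>
    isOpen_iUnion fun _ => isOpen_ne_fun (by fun_prop) continuous_const
  have hsub : (T ×ˢ T) ×ˢ {π} ⊆ O := by
    rintro ⟨⟨X, Y⟩, R⟩ ⟨⟨hX, hY⟩, hR⟩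
    obtain rfl : R = π := hR
    obtain ⟨L₁, hL₁, h₁⟩ := hD R Y (hT0 Y hY) hπ.ne_zero
    obtain ⟨L₂, hL₂, h₂⟩ := hD X R hπ.ne_zero (hT0 X hX)
    obtain ⟨K, hK, h⟩ := ha (2 * D - L₁.length - L₂.length) (by omega)
    simp only [O, Set.mem_iUnion]
    exact ⟨L₁, K, L₂, by omega, hπ.mul_mul_ne_zero hX.1 hY.1 h₁ h₂ h⟩
  obtain ⟨u, v, -, hv, hu, hπv, huv⟩ := generalized_tube_lemma (hTc.prod hTc) isCompact_singleton
    hO hsub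
  obtain ⟨_, hR, c, I, rfl⟩ := mem_closure_iff.1 hπ.mem v hv (hπv rfl)
  refine ⟨M + 2 * I.length, fun X hX Y hY => ?_⟩
  have hmem := @huv ((X, Y), c • wordProd A I) ⟨hu ⟨hX, hY⟩, hR⟩
  simp only [O, Set.mem_iUnion] at hmem
  obtain ⟨K₁, K₂, K₃, hlen, h⟩ := hmem
  refine ⟨K₃ ++ I ++ K₂ ++ I ++ K₁, ?_, fun h0 => h ?_⟩
  · simp only [List.length_append]
    omega
  · simp only [wordProd_append] at h0
    simp only [mul_smul_comm, smul_mul_assoc]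
    rw [show Y * wordProd A K₁ * wordProd A I * wordProd A K₂ * wordProd A I * wordProd A K₃ * X = 0
      by simpa only [Matrix.mul_assoc] using h0, smul_zero, smul_zero]

/-- Quasi-multiplicativity with connecting words of one fixed length. -/
theorem exists_sum_norm_rpow_ge (hd : 1 ≤ d) {A : Fin ℓ → Matrix (Fin d) (Fin d) ℝ}
    (hirr : ∀ t : ℕ, 0 < t → t ∣ d →
      ¬ ∃ V : Submodule ℝ (Fin d → ℝ), V ≠ ⊥ ∧ V ≠ ⊤ ∧
        ∀ I : List (Fin ℓ), I.length = t → V.map (wordProd A I).mulVecLin ≤ V)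
    (hirr₁ : IsIrreducibleCocycle A) {i₀ : Fin ℓ} (hA : ∀ i, IsUnit (A i)) {s : ℝ} (hs : 0 < s) :
    ∃ n₀, ∃ c : ℝ, 0 < c ∧ ∀ I J : List (Fin ℓ), c * ‖wordProd A I‖ ^ s * ‖wordProd A J‖ ^ s ≤
      ∑ K ∈ words ℓ n₀, ‖wordProd A (I ++ K ++ J)‖ ^ s := by
  obtain ⟨n₀, hn₀⟩ := exists_uniform_connecting_length hd hirr hirr₁ (hA i₀)
  set T := closure (scaledProducts A) ∩ Metric.sphere 0 1 with hT
  have hTc : IsCompact T := (isCompact_sphere _ _).inter_left isClosed_closure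
  obtain ⟨c, hc, h⟩ := (hTc.prod hTc).exists_forall_le' (a := 0)
    (f := fun x => ∑ K ∈ words ℓ n₀, ‖x.2 * wordProd A K * x.1‖ ^ s)
    (continuous_finsetSum _ fun K _ => Continuous.rpow_const (by fun_prop)
      fun _ => Or.inr hs.le).continuousOn
    (by
      rintro ⟨X, Y⟩ ⟨hX, hY⟩
      obtain ⟨K, hK, hne⟩ := hn₀ X hX Y hY
      exact Finset.sum_pos' (fun _ _ => by positivity)
        ⟨K, mem_words.2 hK, Real.rpow_pos_of_pos (norm_pos_iff.2 hne) s⟩)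
  refine ⟨n₀, c, hc, fun I J => ?_⟩
  have hpos := norm_wordProd_pos hd hA
  have hunit : ∀ W, ‖wordProd A W‖⁻¹ • wordProd A W ∈ T := fun W => by
    refine ⟨smul_wordProd_mem_closure A _ W, ?_⟩
    rw [mem_sphere_zero_iff_norm, norm_smul, norm_inv, norm_norm, inv_mul_cancel₀ (hpos W).ne']
  have hIJ := h (‖wordProd A I‖⁻¹ • wordProd A I, ‖wordProd A J‖⁻¹ • wordProd A J)
    ⟨hunit I, hunit J⟩
  have hI := hpos I
  have hJ := hpos J
  have hI' := Real.rpow_pos_of_pos hI s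
  have hJ' := Real.rpow_pos_of_pos hJ s
  have e : ∀ K, ‖(‖wordProd A J‖⁻¹ • wordProd A J) * wordProd A K *
      (‖wordProd A I‖⁻¹ • wordProd A I)‖ ^ s * (‖wordProd A I‖ ^ s * ‖wordProd A J‖ ^ s) =
      ‖wordProd A (I ++ K ++ J)‖ ^ s := by
    intro K
    rw [wordProd_append, wordProd_append, smul_mul_assoc, smul_mul_assoc, mul_smul_comm, smul_smul,
      norm_smul, norm_mul, norm_inv, norm_inv, norm_norm, norm_norm,
      Real.mul_rpow (by positivity) (norm_nonneg _), Real.mul_rpow (by positivity) (by positivity),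
      Real.inv_rpow hI.le, Real.inv_rpow hJ.le, Matrix.mul_assoc]
    field_simp
  calc c * ‖wordProd A I‖ ^ s * ‖wordProd A J‖ ^ s
      = c * (‖wordProd A I‖ ^ s * ‖wordProd A J‖ ^ s) := by ring
    _ ≤ _ := mul_le_mul_of_nonneg_right hIJ (by positivity)
    _ = _ := by
      rw [Finset.sum_mul]
      exact Finset.sum_congr rfl fun K _ => e K

/-- A Gibbs weight for an irreducible cocycle satisfies a mixing estimate with a fixed gap. -/
theorem mul_le_sum_of_gibbs {A : Fin ℓ → Matrix (Fin d) (Fin d) ℝ} {s P C₀ c : ℝ}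
    {n₀ : ℕ} {p : List (Fin ℓ) → ℝ} (hC₀ : 0 < C₀) (hc : 0 < c) (hp : ∀ I, 0 < p I)
    (hlow : ∀ I, C₀⁻¹ * gibbsPotential A s P I ≤ p I)
    (hup : ∀ I, p I ≤ C₀ * gibbsPotential A s P I)
    (h : ∀ I J : List (Fin ℓ), c * ‖wordProd A I‖ ^ s * ‖wordProd A J‖ ^ s ≤
      ∑ K ∈ words ℓ n₀, ‖wordProd A (I ++ K ++ J)‖ ^ s) (I J : List (Fin ℓ)) :
    C₀⁻¹ ^ 3 * Real.exp (-(n₀ * P)) * c * p I * p J ≤ ∑ K ∈ words ℓ n₀, p (I ++ K ++ J) := by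
  set e := Real.exp (-((I.length + n₀ + J.length : ℕ) * P)) with he
  have h1 : ∀ K ∈ words ℓ n₀, C₀⁻¹ * e * ‖wordProd A (I ++ K ++ J)‖ ^ s ≤ p (I ++ K ++ J) := by
    intro K hK
    refine le_trans (le_of_eq ?_) (hlow _)
    rw [gibbsPotential, ← mul_assoc, List.length_append, List.length_append, mem_words.1 hK]
  refine le_trans ?_ (Finset.sum_le_sum h1)
  rw [← Finset.mul_sum]
  refine le_trans ?_ (mul_le_mul_of_nonneg_left (h I J) (by positivity))
  have hexp : e = Real.exp (-(n₀ * P)) * Real.exp (-(I.length * P)) *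
      Real.exp (-(J.length * P)) := by
    rw [he, ← Real.exp_add, ← Real.exp_add]
    push_cast
    ring_nf
  have hpI := hp I
  have hpJ := hp J
  have hgI : C₀⁻¹ * p I ≤ gibbsPotential A s P I := (inv_mul_le_iff₀ hC₀).2 (hup I)
  have hgJ : C₀⁻¹ * p J ≤ gibbsPotential A s P J := (inv_mul_le_iff₀ hC₀).2 (hup J)
  have hgI₀ : 0 ≤ gibbsPotential A s P I := le_trans (by positivity) hgI
  calc C₀⁻¹ ^ 3 * Real.exp (-(n₀ * P)) * c * p I * p J
      = C₀⁻¹ * Real.exp (-(n₀ * P)) * c * ((C₀⁻¹ * p I) * (C₀⁻¹ * p J)) := by ring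
    _ ≤ C₀⁻¹ * Real.exp (-(n₀ * P)) * c *
        (gibbsPotential A s P I * gibbsPotential A s P J) := by gcongr
    _ = _ := by
      rw [hexp, gibbsPotential, gibbsPotential]
      ring

end Cocycle

end Auxiliary

theorem gibbs_psi_mixing
    (ℓ d : ℕ) (hℓ : 2 ≤ ℓ) (hd : 1 ≤ d)
    (A : Fin ℓ → Matrix (Fin d) (Fin d) ℝ) (hA : ∀ i, IsUnit (A i))
    (hirr : ∀ t : ℕ, 0 < t → t ∣ d →
      ¬ ∃ V : Submodule ℝ (Fin d → ℝ), V ≠ ⊥ ∧ V ≠ ⊤ ∧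
        ∀ I : List (Fin ℓ), I.length = t → V.map (wordProd A I).mulVecLin ≤ V)
    (hext : ∀ m : ℕ, 1 ≤ m → m ≤ d - 1 →
      ¬ ∃ W : Submodule ℝ (ExteriorAlgebra ℝ (Fin d → ℝ)),
        W ≤ ⋀[ℝ]^m (Fin d → ℝ) ∧ W ≠ ⊥ ∧ W ≠ ⋀[ℝ]^m (Fin d → ℝ) ∧
        ∀ i : Fin ℓ, W.map (ExteriorAlgebra.map (A i).mulVecLin).toLinearMap ≤ W)
    (s : ℝ) (hs : 0 < s)
    (μ : Measure (ℕ → Fin ℓ)) [IsProbabilityMeasure μ]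
    (hinv : MeasurePreserving (shift ℓ) μ μ)
    (P : ℝ) (C₀ : ℝ) (hC₀ : 1 < C₀)
    (hGibbs : ∀ I : List (Fin ℓ),
      C₀⁻¹ * opNorm (wordProd A I) ^ s ≤ Real.exp (I.length * P) * (μ (cylinder I)).toReal ∧
      Real.exp (I.length * P) * (μ (cylinder I)).toReal ≤ C₀ * opNorm (wordProd A I) ^ s) :
    -- ψ-mixing: the supremum over all pairs of words of the mixing defect tends to 0
    ∀ ε : ℝ, 0 < ε → ∃ N : ℕ, ∀ n : ℕ, N ≤ n → ∀ I J : List (Fin ℓ),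
      |(μ (cylinder I ∩ (shift ℓ)^[n + I.length] ⁻¹' cylinder J)).toReal /
          ((μ (cylinder I)).toReal * (μ (cylinder J)).toReal) - 1| < ε := by
  have hC : 0 < C₀ := by linarith
  have hgibbs : ∀ I : List (Fin ℓ), C₀⁻¹ * gibbsPotential A s P I ≤ (μ (cylinder I)).toReal ∧
      (μ (cylinder I)).toReal ≤ C₀ * gibbsPotential A s P I := by
    intro I
    have h1 : Real.exp (-(I.length * P)) * Real.exp (I.length * P) = 1 := by
      rw [← Real.exp_add, neg_add_cancel, Real.exp_zero]
    obtain ⟨h2, h3⟩ := hGibbs I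
    have hpos := Real.exp_pos (-(I.length * P))
    have h4 := mul_le_mul_of_nonneg_left h2 hpos.le
    have h5 := mul_le_mul_of_nonneg_left h3 hpos.le
    rw [← mul_assoc, h1, one_mul] at h5
    rw [← mul_assoc (Real.exp _) (Real.exp _), h1, one_mul] at h4
    rw [opNorm_eq_norm] at h4 h5
    rw [gibbsPotential]
    constructor <;> linarith
  have hpos : ∀ I : List (Fin ℓ), 0 < (μ (cylinder I)).toReal := fun I =>
    (mul_pos (inv_pos.2 hC) (gibbsPotential_pos hd hA s P I)).trans_le (hgibbs I).1
  have hp := isInvariantWeight_cylinder hinv hpos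
  have hirr₁ : IsIrreducibleCocycle A := by
    intro V hV
    by_contra! h
    refine hirr 1 one_pos (one_dvd d) ⟨V, h.1, h.2, fun I hI => ?_⟩
    obtain ⟨i, rfl⟩ := List.length_eq_one_iff.1 hI
    rw [wordProd_singleton]
    rintro _ ⟨x, hx, rfl⟩
    exact hV i x hx
  obtain ⟨n₀, c, hc, hlow⟩ := exists_sum_norm_rpow_ge hd hirr hirr₁ (i₀ := ⟨0, by omega⟩) hA hs
  have hlow' := mul_le_sum_of_gibbs hC hc hpos (fun I => (hgibbs I).1) (fun I => (hgibbs I).2) hlow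
  have hc' : 0 < C₀⁻¹ ^ 3 * Real.exp (-(n₀ * P)) * c := by positivity
  have hg₁ : ∀ I : List (Fin ℓ), C₀⁻¹ * (μ (cylinder I)).toReal ≤ gibbsPotential A s P I :=
    fun I => (inv_mul_le_iff₀ hC).2 (hgibbs I).2
  have hg₂ : ∀ I : List (Fin ℓ), gibbsPotential A s P I ≤ C₀ * (μ (cylinder I)).toReal :=
    fun I => (inv_mul_le_iff₀ hC).1 (hgibbs I).1
  have hsub : ∀ I J : List (Fin ℓ), (μ (cylinder (I ++ J))).toReal ≤
      C₀ ^ 3 * (μ (cylinder I)).toReal * (μ (cylinder J)).toReal := by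
    intro I J
    have hI := gibbsPotential_pos hd hA s P I
    have hJ := gibbsPotential_pos hd hA s P J
    calc (μ (cylinder (I ++ J))).toReal ≤ C₀ * gibbsPotential A s P (I ++ J) := (hgibbs _).2
      _ ≤ C₀ * (gibbsPotential A s P I * gibbsPotential A s P J) := by
        gcongr
        exact gibbsPotential_append_le A hs P I J
      _ ≤ C₀ * ((C₀ * (μ (cylinder I)).toReal) * (C₀ * (μ (cylinder J)).toReal)) := by
        have := hpos I
        gcongr
        · exact hg₂ I
        · exact hg₂ J
      _ = _ := by ring
  have hnet := exists_net_of_comparable hp hc' hlow' (inv_pos.2 hC) hg₁ hg₂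
    (exists_net_gibbsPotential hd hA hs P hC hpos hg₂)
  intro ε hε
  obtain ⟨N, hN⟩ := gapRatio_uniform hp hsub hc' hlow' hnet ε hε
  refine ⟨N, fun n hn I J => ?_⟩
  rw [measure_inter_preimage_eq_sum]
  exact hN n hn I J
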